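/- arXiv:2201.09129 — 2 statements merged into one kernel-verified Lean document; each statement's English description precedes it below -/
import Mathlib

section
/- (Žmud's theorem, generalized.) Let G be a finite group, F a field of characteristic ℓ, and k ≥ 1. Then the following are equivalent: (1) ℓ does not divide |A(G)| and the socle S(G) is k-generated as a normal subgroup of G; (2) there exists an F[G]-module V that is a direct sum of k simple F[G]-modules and on which G acts faithfully (the only element of G acting as the identity on V is 1); that is, G has a faithful completely reducible representation over F with k irreducible constituents. -/
variable {G : Type*} [Group G]

/-- A minimal normal subgroup of a group `G`: a nontrivial normal subgroup that is
minimal among the nontrivial normal subgroups of `G`. -/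
def IsMinimalNormal (M : Subgroup G) : Prop :=
  M.Normal ∧ M ≠ ⊥ ∧ ∀ K : Subgroup G, K.Normal → K ≠ ⊥ → K ≤ M → K = M

/-- `A(G)`: the subgroup generated by all abelian minimal normal subgroups of `G`. -/
def aSocle (G : Type*) [Group G] : Subgroup G :=
  sSup {M : Subgroup G | IsMinimalNormal M ∧ ∀ x ∈ M, ∀ y ∈ M, x * y = y * x}

/-- The socle `S(G)`: the subgroup generated by all minimal normal subgroups of `G`. -/
def socle (G : Type*) [Group G] : Subgroup G :=
  sSup {M : Subgroup G | IsMinimalNormal M}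

/-- `H` is generated by `k` (not necessarily distinct) elements as a normal subgroup of
`G`: there are `k` elements of `H` whose normal closure in `G` is `H`. -/
def NormallyKGenerated (H : Subgroup G) (k : ℕ) : Prop :=
  ∃ f : Fin k → G, (∀ i, f i ∈ H) ∧ Subgroup.normalClosure (Set.range f) = H


namespace Zmud
universe u v w

section ModulePart
variable {R : Type u} [Ring R]

/-- Induction principle for finite semisimple modules. -/
theorem semisimple_induction
    (P : ∀ (X : Type v) [AddCommGroup X] [Module R X], Prop)
    (h0 : ∀ (X : Type v) [AddCommGroup X] [Module R X], Subsingleton X → P X)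
    (hcongr : ∀ (X Y : Type v) [AddCommGroup X] [Module R X] [AddCommGroup Y] [Module R Y],
      (X ≃ₗ[R] Y) → P X → P Y)
    (hprod : ∀ (Y M : Type v) [AddCommGroup Y] [Module R Y] [AddCommGroup M] [Module R M],
      Finite Y → Finite M → IsSimpleModule R M → IsSemisimpleModule R Y → P Y → P (Y × M))
    (X : Type v) [AddCommGroup X] [Module R X] [Finite X] [IsSemisimpleModule R X] : P X := by
  obtain ⟨n, hn⟩ : ∃ n, Nat.card X = n := ⟨_, rfl⟩
  induction n using Nat.strong_induction_on generalizing X with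
  | _ n ih =>
  rcases subsingleton_or_nontrivial X with hs | hs
  · exact h0 X hs
  obtain ⟨M, hM⟩ := IsSemisimpleModule.exists_simple_submodule R X
  obtain ⟨Y, hY⟩ := exists_isCompl M
  let e := Submodule.prodEquivOfIsCompl Y M hY.symm
  refine hcongr _ _ e (hprod Y M inferInstance inferInstance hM inferInstance ?_)
  have := IsSimpleModule.nontrivial R M
  have hc : Nat.card X = Nat.card Y * Nat.card M := by
    rw [← Nat.card_congr e.toEquiv, Nat.card_prod]
  have h1 : 1 < Nat.card M := Finite.one_lt_card
  have h2 : 0 < Nat.card Y := Nat.card_pos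
  exact ih (Nat.card Y) (by rw [← hn, hc]; nlinarith) Y rfl

instance finite_lin {X Y : Type*} [AddCommGroup X] [Module R X] [AddCommGroup Y] [Module R Y]
    [Finite X] [Finite Y] : Finite (X →ₗ[R] Y) :=
  Finite.of_injective (fun f => (f : X → Y)) DFunLike.coe_injective

/-- Postcomposition with a linear equivalence. -/
def homCongrRight {X Y Z : Type*} [AddCommGroup X] [Module R X] [AddCommGroup Y] [Module R Y]
    [AddCommGroup Z] [Module R Z] (e : X ≃ₗ[R] Y) : (Z →ₗ[R] X) ≃ (Z →ₗ[R] Y) where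
  toFun f := e.toLinearMap ∘ₗ f
  invFun f := e.symm.toLinearMap ∘ₗ f
  left_inv f := by ext; simp
  right_inv f := by ext; simp

theorem card_hom_symm_simple (M N : Type v) [AddCommGroup M] [Module R M] [AddCommGroup N]
    [Module R N] [IsSimpleModule R M] [IsSimpleModule R N] :
    Nat.card (N →ₗ[R] M) = Nat.card (M →ₗ[R] N) := by
  by_cases h : Nonempty (M ≃ₗ[R] N)
  · obtain ⟨e⟩ := h
    exact Nat.card_congr ((LinearEquiv.congrLeft M ℕ e.symm).toEquiv.trans
      (homCongrRight e))
  · have h1 : ∀ f : M →ₗ[R] N, f = 0 := fun f => by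
      by_contra hf
      exact h ⟨LinearEquiv.ofBijective f (LinearMap.bijective_of_ne_zero hf)⟩
    have h2 : ∀ f : N →ₗ[R] M, f = 0 := fun f => by
      by_contra hf
      exact h ⟨(LinearEquiv.ofBijective f (LinearMap.bijective_of_ne_zero hf)).symm⟩
    have : Unique (M →ₗ[R] N) := ⟨⟨0⟩, h1⟩
    have : Unique (N →ₗ[R] M) := ⟨⟨0⟩, h2⟩
    simp

theorem card_hom_prod_left (Y M N : Type v) [AddCommGroup Y] [Module R Y] [AddCommGroup M]
    [Module R M] [AddCommGroup N] [Module R N] :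
    Nat.card (Y × M →ₗ[R] N) = Nat.card (Y →ₗ[R] N) * Nat.card (M →ₗ[R] N) := by
  rw [← Nat.card_prod]
  exact (Nat.card_congr (LinearMap.coprodEquiv (S := ℕ)).toEquiv).symm

theorem card_hom_prod_right (Y M N : Type v) [AddCommGroup Y] [Module R Y] [AddCommGroup M]
    [Module R M] [AddCommGroup N] [Module R N] :
    Nat.card (N →ₗ[R] Y × M) = Nat.card (N →ₗ[R] Y) * Nat.card (N →ₗ[R] M) := by
  rw [← Nat.card_prod]
  exact (Nat.card_congr (LinearMap.prodEquiv (S := ℕ)).toEquiv).symm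

theorem card_hom_symm (M : Type v) [AddCommGroup M] [Module R M] [IsSimpleModule R M]
    (X : Type v) [AddCommGroup X] [Module R X] [Finite X] [IsSemisimpleModule R X] :
    Nat.card (X →ₗ[R] M) = Nat.card (M →ₗ[R] X) := by
  refine semisimple_induction (R := R)
    (fun X _ _ => Nat.card (X →ₗ[R] M) = Nat.card (M →ₗ[R] X)) ?_ ?_ ?_ X
  · intro X _ _ hX
    have : Unique (X →ₗ[R] M) := ⟨⟨0⟩, fun f => by ext x; simp [Subsingleton.elim x 0]⟩
    have : Unique (M →ₗ[R] X) := ⟨⟨0⟩, fun f => by ext x; exact Subsingleton.elim _ _⟩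
    simp
  · intro X Y _ _ _ _ e h
    rw [← Nat.card_congr (LinearEquiv.congrLeft M ℕ e).toEquiv, h]
    exact Nat.card_congr (homCongrRight e)
  · intro Y N _ _ _ _ _ _ _ _ h
    rw [card_hom_prod_left, card_hom_prod_right, h, card_hom_symm_simple M N]

theorem two_le_card_end (M : Type v) [AddCommGroup M] [Module R M] [IsSimpleModule R M]
    [Finite M] : 2 ≤ Nat.card (M →ₗ[R] M) := by
  have := IsSimpleModule.nontrivial R M
  have : Nontrivial (M →ₗ[R] M) := inferInstanceAs (Nontrivial (Module.End R M))
  exact Finite.one_lt_card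

/-- S2 -/
theorem card_hom_le_of_span {X : Type v} [AddCommGroup X] [Module R X]
    {k : ℕ} (f : Fin k → X) (hf : Submodule.span R (Set.range f) = ⊤)
    (M : Type v) [AddCommGroup M] [Module R M] [Finite M] :
    Nat.card (X →ₗ[R] M) ≤ Nat.card M ^ k := by
  have : Nat.card (Fin k → M) = Nat.card M ^ k := by simp [Nat.card_fun]
  rw [← this]
  refine Nat.card_le_card_of_injective (fun h i => h (f i)) ?_
  intro h h' hh
  refine LinearMap.ext_on hf ?_
  rintro _ ⟨i, rfl⟩
  exact congrFun hh i

/-- S4 -/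
theorem exists_span_of_card_hom_le (c k : ℕ)
    (X : Type v) [AddCommGroup X] [Module R X] [Finite X] [IsSemisimpleModule R X] :
    Nat.card X ∣ c →
    (∀ (M : Type v) [AddCommGroup M] [Module R M], IsSimpleModule R M → Finite M →
      Nat.card M ∣ c → Nat.card (X →ₗ[R] M) ≤ Nat.card M ^ k) →
    ∃ f : Fin k → X, Submodule.span R (Set.range f) = ⊤ := by
  refine semisimple_induction (R := R) (fun X _ _ => Nat.card X ∣ c →
    (∀ (M : Type v) [AddCommGroup M] [Module R M], IsSimpleModule R M → Finite M →
      Nat.card M ∣ c → Nat.card (X →ₗ[R] M) ≤ Nat.card M ^ k) →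
    ∃ f : Fin k → X, Submodule.span R (Set.range f) = ⊤) ?_ ?_ ?_ X
  · intro X _ _ hX _ _
    exact ⟨fun _ => 0, Subsingleton.elim _ _⟩
  · intro X Y _ _ _ _ e ih hc h
    obtain ⟨f, hf⟩ := ih (by rwa [Nat.card_congr e.toEquiv]) (fun M _ _ h1 h2 h3 => by
      rw [Nat.card_congr (LinearEquiv.congrLeft M ℕ e).toEquiv]; exact h M h1 h2 h3)
    refine ⟨e ∘ f, ?_⟩
    rw [Set.range_comp, ← LinearEquiv.coe_coe, ← Submodule.map_span, hf]
    simp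
  · intro Y M _ _ _ _ _ _ _ _ ih hc h
    rw [Nat.card_prod] at hc
    have hMc : Nat.card M ∣ c := (Dvd.intro_left _ rfl).trans hc
    obtain ⟨f, hf⟩ := ih ((Dvd.intro _ rfl).trans hc) (fun N _ _ h1 h2 h3 => by
      refine le_trans ?_ (h N h1 h2 h3)
      rw [card_hom_prod_left]
      exact Nat.le_mul_of_pos_right _ Nat.card_pos)
    have hlt : Nat.card (Y →ₗ[R] M) < Nat.card (Fin k → M) := by
      have h1 := h M inferInstance inferInstance hMc
      rw [card_hom_prod_left] at h1
      have h2 := two_le_card_end (R := R) M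
      have h3 : 0 < Nat.card (Y →ₗ[R] M) := Nat.card_pos
      have : Nat.card (Fin k → M) = Nat.card M ^ k := by simp [Nat.card_fun]
      rw [this]
      nlinarith
    have hns : ¬ Function.Surjective (fun (g : Y →ₗ[R] M) (i : Fin k) => g (f i)) := fun hs =>
      absurd (Nat.card_le_card_of_surjective _ hs) (by omega)
    rw [Function.Surjective] at hns
    push Not at hns
    obtain ⟨x, hx⟩ := hns
    refine ⟨fun i => (f i, x i), ?_⟩
    set P := Submodule.span R (Set.range fun i => (f i, x i)) with hP
    have hmem : ∀ i, (f i, x i) ∈ P := fun i => Submodule.subset_span ⟨i, rfl⟩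
    let q : P →ₗ[R] Y := LinearMap.fst R Y M ∘ₗ P.subtype
    have hq : Function.Surjective q := by
      rw [← LinearMap.range_eq_top, eq_top_iff, ← hf, Submodule.span_le]
      rintro _ ⟨i, rfl⟩
      exact ⟨⟨_, hmem i⟩, rfl⟩
    have hM : P.comap (LinearMap.inr R Y M) = ⊤ := by
      rcases eq_bot_or_eq_top (P.comap (LinearMap.inr R Y M)) with hb | ht
      · exfalso
        have hqi : Function.Injective q := by
          rw [← LinearMap.ker_eq_bot, eq_bot_iff]
          rintro ⟨⟨y, m⟩, hp⟩ hy
          have hy' : y = 0 := hy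
          subst hy'
          have : m ∈ P.comap (LinearMap.inr R Y M) := hp
          rw [hb] at this
          have : m = 0 := this
          subst this
          rfl
        let e := LinearEquiv.ofBijective q ⟨hqi, hq⟩
        refine hx (LinearMap.snd R Y M ∘ₗ P.subtype ∘ₗ e.symm.toLinearMap) ?_
        ext i
        have : e.symm (f i) = ⟨_, hmem i⟩ := by
          rw [LinearEquiv.symm_apply_eq]; rfl
        simp [this]
      · exact ht
    rw [eq_top_iff]
    rintro ⟨y, m⟩ -
    obtain ⟨⟨⟨y', m'⟩, hp⟩, hy⟩ := hq y
    have hy' : y' = y := hy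
    subst hy'
    have h2 : m - m' ∈ P.comap (LinearMap.inr R Y M) := by rw [hM]; trivial
    have h3 : ((0 : Y), m - m') ∈ P := h2
    simpa using P.add_mem hp h3

/-- S3 -/
theorem card_hom_le_of_chars {D : Type w} [AddCommGroup D] {X : Type v} [AddCommGroup X]
    [Module R X] {k : ℕ} (χ : Fin k → (X →+ D))
    (hχ : ∀ N : Submodule R X, (∀ i, ∀ n ∈ N, χ i n = 0) → N = ⊥)
    (M : Type v) [AddCommGroup M] [Module R M] [Finite M]
    (hD : Nat.card (M →+ D) = Nat.card M) :
    Nat.card (M →ₗ[R] X) ≤ Nat.card M ^ k := by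
  have hfin : Finite (M →+ D) := Nat.finite_of_card_ne_zero (by rw [hD]; exact Nat.card_pos.ne')
  have : Nat.card (Fin k → (M →+ D)) = Nat.card M ^ k := by simp [Nat.card_fun, hD]
  rw [← this]
  refine Nat.card_le_card_of_injective (fun h i => (χ i).comp h.toAddMonoidHom) ?_
  intro h h' hh
  have := hχ (LinearMap.range (h - h')) (by
    rintro i _ ⟨m, rfl⟩
    have := DFunLike.congr_fun (congrFun hh i) m
    simp at this
    simp [this])
  rw [LinearMap.range_eq_bot] at this
  exact sub_eq_zero.mp this

/-- S5 -/
theorem exists_chars_of_card_hom_le {D : Type w} [AddCommGroup D] (c k : ℕ)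
    (hD : ∀ (M : Type v) [AddCommGroup M], Finite M → Nat.card M ∣ c →
      Nat.card (M →+ D) = Nat.card M)
    (X : Type v) [AddCommGroup X] [Module R X] [Finite X] [IsSemisimpleModule R X] :
    Nat.card X ∣ c →
    (∀ (M : Type v) [AddCommGroup M] [Module R M], IsSimpleModule R M → Finite M →
      Nat.card M ∣ c → Nat.card (M →ₗ[R] X) ≤ Nat.card M ^ k) →
    ∃ χ : Fin k → (X →+ D), ∀ N : Submodule R X, (∀ i, ∀ n ∈ N, χ i n = 0) → N = ⊥ := by
  refine semisimple_induction (R := R) (fun X _ _ => Nat.card X ∣ c →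
    (∀ (M : Type v) [AddCommGroup M] [Module R M], IsSimpleModule R M → Finite M →
      Nat.card M ∣ c → Nat.card (M →ₗ[R] X) ≤ Nat.card M ^ k) →
    ∃ χ : Fin k → (X →+ D), ∀ N : Submodule R X, (∀ i, ∀ n ∈ N, χ i n = 0) → N = ⊥) ?_ ?_ ?_ X
  · intro X _ _ hX _ _
    exact ⟨fun _ => 0, fun _ _ => Subsingleton.elim _ _⟩
  · intro X Y _ _ _ _ e ih hc h
    obtain ⟨χ, hχ⟩ := ih (by rwa [Nat.card_congr e.toEquiv]) (fun M _ _ h1 h2 h3 => by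
      rw [Nat.card_congr (homCongrRight e)]; exact h M h1 h2 h3)
    refine ⟨fun i => (χ i).comp e.symm.toLinearMap.toAddMonoidHom, fun N hN => ?_⟩
    have := hχ (N.comap e.toLinearMap) (fun i n hn => by simpa using hN i _ hn)
    rw [eq_bot_iff]
    intro y hy
    have h2 : e.symm y ∈ N.comap e.toLinearMap := by simpa using hy
    rw [this] at h2
    simpa using h2
  · intro Y M _ _ _ _ _ _ _ _ ih hc h
    rw [Nat.card_prod] at hc
    have hMc : Nat.card M ∣ c := (Dvd.intro_left _ rfl).trans hc
    obtain ⟨χ, hχ⟩ := ih ((Dvd.intro _ rfl).trans hc) (fun N _ _ h1 h2 h3 => by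
      refine le_trans ?_ (h N h1 h2 h3)
      rw [card_hom_prod_right]
      exact Nat.le_mul_of_pos_right _ Nat.card_pos)
    have hlt : Nat.card (M →ₗ[R] Y) < Nat.card (Fin k → (M →+ D)) := by
      have h1 := h M inferInstance inferInstance hMc
      rw [card_hom_prod_right] at h1
      have h2 := two_le_card_end (R := R) M
      have h3 : 0 < Nat.card (M →ₗ[R] Y) := Nat.card_pos
      have : Nat.card (Fin k → (M →+ D)) = Nat.card M ^ k := by
        simp [Nat.card_fun, hD M inferInstance hMc]
      rw [this]
      nlinarith
    have hns : ¬ Function.Surjective (fun (g : M →ₗ[R] Y) (i : Fin k) =>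
        (χ i).comp g.toAddMonoidHom) := fun hs =>
      absurd (Nat.card_le_card_of_surjective _ hs) (by omega)
    rw [Function.Surjective] at hns
    push Not at hns
    obtain ⟨ψ, hψ⟩ := hns
    refine ⟨fun i => (χ i).comp (AddMonoidHom.fst Y M) - (ψ i).comp (AddMonoidHom.snd Y M), ?_⟩
    intro N hN
    have h1 := hχ (N.comap (LinearMap.inl R Y M)) (fun i n hn => by simpa using hN i _ hn)
    let q : N →ₗ[R] M := LinearMap.snd R Y M ∘ₗ N.subtype
    have hqi : Function.Injective q := by
      rw [← LinearMap.ker_eq_bot, eq_bot_iff]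
      rintro ⟨⟨y, m⟩, hp⟩ hy
      have hy' : m = 0 := hy
      subst hy'
      have : y ∈ N.comap (LinearMap.inl R Y M) := hp
      rw [h1] at this
      have : y = 0 := this
      subst this
      rfl
    rcases eq_bot_or_eq_top (LinearMap.range q) with hb | ht
    · rw [LinearMap.range_eq_bot] at hb
      rw [eq_bot_iff]
      intro n hn
      have : (⟨n, hn⟩ : N) = 0 := hqi (by simp [hb])
      simpa using congrArg Subtype.val this
    · exfalso
      let e := LinearEquiv.ofBijective q ⟨hqi, LinearMap.range_eq_top.mp ht⟩
      refine hψ (LinearMap.fst R Y M ∘ₗ N.subtype ∘ₗ e.symm.toLinearMap) ?_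
      ext i m
      have h2 := hN i _ (e.symm m).2
      have h3 : (e.symm m).1.2 = m := e.apply_symm_apply m
      simp [h3, sub_eq_zero] at h2
      simpa using h2

/-- The duality theorem. -/
theorem span_iff_chars {D : Type w} [AddCommGroup D] (k : ℕ)
    (X : Type v) [AddCommGroup X] [Module R X] [Finite X] [IsSemisimpleModule R X]
    (hD : ∀ (M : Type v) [AddCommGroup M], Finite M → Nat.card M ∣ Nat.card X →
      Nat.card (M →+ D) = Nat.card M) :
    (∃ f : Fin k → X, Submodule.span R (Set.range f) = ⊤) ↔
    ∃ χ : Fin k → (X →+ D), ∀ N : Submodule R X, (∀ i, ∀ n ∈ N, χ i n = 0) → N = ⊥ := by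
  constructor
  · rintro ⟨f, hf⟩
    refine exists_chars_of_card_hom_le (Nat.card X) k hD X dvd_rfl ?_
    intro M _ _ _ _ hc
    rw [← card_hom_symm]
    exact card_hom_le_of_span f hf M
  · rintro ⟨χ, hχ⟩
    refine exists_span_of_card_hom_le (Nat.card X) k X dvd_rfl ?_
    intro M _ _ _ _ hc
    rw [card_hom_symm]
    exact card_hom_le_of_chars χ hχ M (hD M inferInstance hc)

end ModulePart
end Zmud

namespace Zmud
section RepPart
open MonoidAlgebra

/-- Lemma D. -/
theorem exists_char_of_simple {G : Type} [Group G] [Finite G] {F : Type} [Field F]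
    (K : Type) [Field K] [Algebra F K] [IsAlgClosed K]
    (M : Type) [AddCommGroup M] [Module (MonoidAlgebra F G) M]
    [IsSimpleModule (MonoidAlgebra F G) M]
    (A : Type) [CommGroup A] [Finite A] (ι : A →* G) :
    ∃ χ : A →* Kˣ, ∀ N : Subgroup G, N.Normal →
      (∀ n ∈ N, ∃ a, ι a = n ∧ χ a = 1) → ∀ n ∈ N, ∀ m : M, of F G n • m = m := by
  let ψ : MonoidAlgebra F A →ₐ[F] MonoidAlgebra F G := MonoidAlgebra.mapDomainAlgHom F F ι
  let : Module (MonoidAlgebra F A) M := Module.compHom M ψ.toRingHom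
  have hsm : ∀ (c : MonoidAlgebra F A) (m : M), c • m = ψ c • m := fun _ _ => rfl
  have : Module.Finite F (MonoidAlgebra F A) := inferInstance
  have : IsNoetherianRing (MonoidAlgebra F A) := isNoetherian_of_tower F inferInstance
  have := IsSimpleModule.nontrivial (MonoidAlgebra F G) M
  obtain ⟨x, hx⟩ := exists_ne (0 : M)
  obtain ⟨P, hP, -⟩ := exists_le_isAssociatedPrime_of_isNoetherianRing (MonoidAlgebra F A) x hx
  rw [isAssociatedPrime_iff] at hP
  obtain ⟨hPp, v, hv⟩ := hP
  have : Algebra.IsIntegral F (MonoidAlgebra F A) := inferInstance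
  have : Algebra.IsAlgebraic F (MonoidAlgebra F A ⧸ P) := inferInstance
  have : Module.IsTorsionFree F (MonoidAlgebra F A ⧸ P) := inferInstance
  let θ : (MonoidAlgebra F A ⧸ P) →ₐ[F] K := IsAlgClosed.lift
  have hfld : IsField (MonoidAlgebra F A ⧸ P) :=
    isField_of_isIntegral_of_isField' (R := F) (Field.toIsField F)
  have hθ : Function.Injective θ := by
    let := hfld.toField
    exact θ.toRingHom.injective
  let θ' : MonoidAlgebra F A →* K := (θ.comp (Ideal.Quotient.mkₐ F P)).toMonoidHom
  let χ : A →* Kˣ := (θ'.comp (of F A)).toHomUnits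
  refine ⟨χ, ?_⟩
  intro N hN hχ
  have hv0 : v ≠ 0 := by
    rintro rfl
    apply hPp.ne_top
    rw [hv]
    ext y
    simp [Submodule.mem_colon_singleton]
  have hfix : ∀ n ∈ N, of F G n • v = v := by
    intro n hn
    obtain ⟨a, rfl, ha⟩ := hχ n hn
    have h1 : θ (Ideal.Quotient.mk P (of F A a)) = 1 := congrArg Units.val ha
    have h2 : Ideal.Quotient.mk P (of F A a) = 1 := hθ (by rw [h1, map_one])
    have h3 : of F A a - 1 ∈ P := by
      rw [← Ideal.Quotient.eq_zero_iff_mem, map_sub, h2, map_one, sub_self]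
    rw [hv, Submodule.mem_colon_singleton, Submodule.mem_bot, hsm, map_sub, map_one, sub_smul,
      one_smul, sub_eq_zero] at h3
    convert h3 using 2
    simp [ψ]
  let Fix : Submodule (MonoidAlgebra F G) M :=
    { carrier := {w | ∀ n ∈ N, of F G n • w = w}
      zero_mem' := by intro n _; simp
      add_mem' := by
        intro a b ha hb n hn
        rw [smul_add, ha n hn, hb n hn]
      smul_mem' := by
        intro r w hw
        induction r using MonoidAlgebra.induction_on with
        | of g =>
          intro n hn
          have h1 := hw (g⁻¹ * n * g) (by simpa using hN.conj_mem n hn g⁻¹)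
          rw [← mul_smul, ← map_mul]
          conv_rhs => rw [← h1, ← mul_smul, ← map_mul]
          congr 2
          group
        | add a b ha hb =>
          intro n hn
          rw [add_smul, smul_add, ha n hn, hb n hn]
        | smul c a ha =>
          intro n hn
          have : c • a = algebraMap F (MonoidAlgebra F G) c * a := by rw [Algebra.smul_def]
          rw [this, mul_smul, ← mul_smul (of F G n), ← Algebra.commutes, mul_smul, ha n hn] }
  have hFix : Fix = ⊤ := by
    rcases eq_bot_or_eq_top Fix with h | h
    · exfalso
      have : v ∈ Fix := hfix
      rw [h] at this
      exact hv0 this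
    · exact h
  intro n hn m
  have : m ∈ Fix := by rw [hFix]; trivial
  exact this n hn

/-- Lemma E. -/
theorem exists_simple_of_char {G : Type} [Group G] [Finite G] {F : Type} [Field F]
    (K : Type) [Field K] [Algebra F K]
    (B : Type) [CommGroup B] [Finite B] (ι : B →* G) (hι : Function.Injective ι) (χ : B →* Kˣ) :
    ∃ L : Submodule (MonoidAlgebra F G) (MonoidAlgebra F G),
      IsSimpleModule (MonoidAlgebra F G) (MonoidAlgebra F G ⧸ L) ∧
      ∀ b, χ b ≠ 1 → ∃ w : MonoidAlgebra F G ⧸ L, of F G (ι b) • w ≠ w := by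
  classical
  let c : G → K := fun g => if h : ∃ b, ι b = g then (χ h.choose : K) else 0
  have hc : ∀ b, c (ι b) = χ b := fun b => by
    have h : ∃ b', ι b' = ι b := ⟨b, rfl⟩
    simp only [c, dif_pos h]
    rw [hι h.choose_spec]
  have hc' : ∀ g b, c (g * ι b) = c g * χ b := by
    intro g b
    by_cases h : ∃ b, ι b = g
    · obtain ⟨a, rfl⟩ := h
      rw [← map_mul, hc, hc, map_mul, Units.val_mul]
    · have h2 : ¬ ∃ b', ι b' = g * ι b := by
        rintro ⟨b', hb⟩
        exact h ⟨b' * b⁻¹, by rw [map_mul, hb, map_inv, mul_inv_cancel_right]⟩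
      simp only [c, dif_neg h, dif_neg h2, zero_mul]
  let φ : MonoidAlgebra F G →ₗ[F] K :=
    (Finsupp.linearCombination F c) ∘ₗ (MonoidAlgebra.coeffLinearEquiv F).toLinearMap
  have hφ : ∀ g, φ (of F G g) = c g := fun g => by
    simp [φ]
  have hφm : ∀ r b, φ (r * of F G (ι b)) = φ r * χ b := by
    intro r b
    induction r using MonoidAlgebra.induction_on with
    | of g => rw [← map_mul, hφ, hφ, hc']
    | add x y hx hy => rw [add_mul, map_add, map_add, hx, hy, add_mul]
    | smul a x hx => rw [smul_mul_assoc, map_smul, map_smul, hx, smul_mul_assoc]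
  let L0 : Submodule (MonoidAlgebra F G) (MonoidAlgebra F G) :=
    { carrier := {x | ∀ r, φ (r * x) = 0}
      zero_mem' := by intro r; simp
      add_mem' := by intro x y hx hy r; rw [mul_add, map_add, hx, hy, add_zero]
      smul_mem' := by
        intro s x hx r
        rw [smul_eq_mul, ← mul_assoc]
        exact hx _ }
  have h1 : L0 ≠ ⊤ := by
    intro h
    have h2 : (1 : MonoidAlgebra F G) ∈ L0 := by rw [h]; trivial
    have h3 := h2 1
    rw [one_mul, ← map_one (of F G), ← map_one ι, hφ, hc] at h3
    simp at h3
  obtain ⟨L, hL, hL0⟩ := Ideal.exists_le_maximal (α := MonoidAlgebra F G) L0 h1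
  refine ⟨L, isSimpleModule_iff_isCoatom.mpr hL.out, ?_⟩
  intro b hb
  refine ⟨Submodule.Quotient.mk 1, ?_⟩
  intro hfix
  set v : MonoidAlgebra F G ⧸ L := Submodule.Quotient.mk 1 with hv
  have hv0 : v ≠ 0 := by
    rw [hv, Ne, Submodule.Quotient.mk_eq_zero]
    exact fun h => hL.ne_top ((Ideal.eq_top_iff_one _).mpr h)
  set ζ : K := (χ b : K) with hζ
  have hζ1 : ζ ≠ 1 := fun h => hb (Units.ext h)
  have hfin : IsOfFinOrder ζ := by
    have h1 : IsOfFinOrder b := isOfFinOrder_of_finite b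
    exact ((Units.coeHom K).comp χ).isOfFinOrder h1
  have hprim : IsPrimitiveRoot ζ (orderOf ζ) := IsPrimitiveRoot.orderOf ζ
  set n := orderOf ζ with hn
  have hnpos : 0 < n := hfin.orderOf_pos
  have : NeZero n := ⟨hnpos.ne'⟩
  have hnK : ((n : ℕ) : K) ≠ 0 := (hprim.neZero').out
  have hnF : ((n : ℕ) : F) ≠ 0 := by
    intro h
    apply hnK
    rw [← map_natCast (algebraMap F K), h, map_zero]
  have h1n : 1 < n := by
    rcases Nat.lt_or_ge 1 n with h | h
    · exact h
    · exfalso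
      have : n = 1 := by omega
      exact hζ1 (orderOf_eq_one_iff.mp this)
  set y : MonoidAlgebra F G := ∑ i ∈ Finset.range n, of F G (ι (b ^ i)) with hy
  have hyL : y ∈ L0 := by
    intro r
    rw [hy, Finset.mul_sum, map_sum]
    simp_rw [hφm, ← Finset.mul_sum]
    simp only [map_pow, Units.val_pow_eq_pow_val]
    rw [← hζ, hprim.geom_sum_eq_zero h1n, mul_zero]
  have hpow : ∀ i : ℕ, of F G (ι (b ^ i)) • v = v := by
    intro i
    induction i with
    | zero => rw [pow_zero, map_one, map_one, one_smul]
    | succ i ih => rw [pow_succ, map_mul, map_mul, mul_smul, hfix, ih]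
  have hyv : y • v = 0 := by
    rw [hv, ← Submodule.Quotient.mk_smul, Submodule.Quotient.mk_eq_zero, smul_eq_mul, mul_one]
    exact hL0 hyL
  rw [hy, Finset.sum_smul, Finset.sum_congr rfl (fun i _ => hpow i), Finset.sum_const,
    Finset.card_range] at hyv
  apply hv0
  have h5 : algebraMap F (MonoidAlgebra F G) ((n : F)⁻¹) • (n • v) = v := by
    rw [← Nat.cast_smul_eq_nsmul (MonoidAlgebra F G) n v, ← mul_smul,
      ← map_natCast (algebraMap F (MonoidAlgebra F G)) n, ← map_mul, inv_mul_cancel₀ hnF, map_one,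
      one_smul]
  rw [← h5, hyv, smul_zero]

end RepPart
end Zmud
namespace Zmud
section GroupPart
open scoped IsMulCommutative
variable {G : Type} [Group G]

/-- Nonabelian minimal normal subgroups. -/
def NonAb (N : Subgroup G) : Prop :=
  IsMinimalNormal N ∧ ¬ ∀ x ∈ N, ∀ y ∈ N, x * y = y * x

theorem le_centralizer_of_ne {M N : Subgroup G} (hM : IsMinimalNormal M)
    (hN : IsMinimalNormal N) (h : M ≠ N) : M ≤ Subgroup.centralizer (N : Set G) := by
  have hMn := hM.1
  have hNn := hN.1
  have hd : M ⊓ N = ⊥ := by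
    by_contra hb
    have h1 := hM.2.2 (M ⊓ N) inferInstance hb inf_le_left
    have h2 := hN.2.2 (M ⊓ N) inferInstance hb inf_le_right
    exact h (h1.symm.trans h2)
  intro x hx
  rw [Subgroup.mem_centralizer_iff]
  intro y hy
  exact (Subgroup.commute_of_normal_of_disjoint M N hMn hNn (disjoint_iff.mpr hd) x y hx hy).symm

theorem eq_one_of_nonAb {N : Subgroup G} (hN : NonAb N) {x : G} (hx : x ∈ N)
    (hc : x ∈ Subgroup.centralizer (N : Set G)) : x = 1 := by
  have hn := hN.1.1
  by_contra h1
  have hb : N ⊓ Subgroup.centralizer (N : Set G) ≠ ⊥ := by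
    intro hb
    have : x ∈ N ⊓ Subgroup.centralizer (N : Set G) := ⟨hx, hc⟩
    rw [hb] at this
    exact h1 this
  have h2 := hN.1.2.2 (N ⊓ Subgroup.centralizer (N : Set G)) inferInstance hb inf_le_left
  apply hN.2
  intro a ha b hb'
  rw [← h2] at hb'
  exact Subgroup.mem_centralizer_iff.mp hb'.2 a ha

theorem exists_minimalNormal_le [Finite G] (H : Subgroup G) (hH : H.Normal) (hb : H ≠ ⊥) :
    ∃ N, IsMinimalNormal N ∧ N ≤ H := by
  obtain ⟨N, hN⟩ := (Set.toFinite {N : Subgroup G | N.Normal ∧ N ≠ ⊥ ∧ N ≤ H}).exists_minimal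
    ⟨H, hH, hb, le_rfl⟩
  refine ⟨N, ⟨hN.1.1, hN.1.2.1, ?_⟩, hN.1.2.2⟩
  intro K hK hKb hKN
  exact le_antisymm hKN (hN.2 ⟨hK, hKb, hKN.trans hN.1.2.2⟩ hKN)

instance aSocle_normal : (aSocle G).Normal := by
  unfold aSocle
  rw [sSup_eq_iSup']
  have : ∀ M : {M : Subgroup G | IsMinimalNormal M ∧ ∀ x ∈ M, ∀ y ∈ M, x * y = y * x},
    (M : Subgroup G).Normal := fun M => M.2.1.1
  infer_instance

theorem aSocle_le_centralizer {N : Subgroup G} (hN : NonAb N) :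
    aSocle G ≤ Subgroup.centralizer (N : Set G) := by
  refine sSup_le ?_
  rintro M ⟨hM, hc⟩
  refine le_centralizer_of_ne hM hN.1 ?_
  rintro rfl
  exact hN.2 hc

theorem aSocle_comm : aSocle G ≤ Subgroup.centralizer (aSocle G : Set G) := by
  refine sSup_le ?_
  rintro M ⟨hM, hc⟩
  rw [Subgroup.le_centralizer_iff]
  refine sSup_le ?_
  rintro M' ⟨hM', hc'⟩
  by_cases h : M' = M
  · subst h
    intro x hx
    rw [Subgroup.mem_centralizer_iff]
    exact fun y hy => hc y hy x hx
  · exact le_centralizer_of_ne hM' hM h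

instance aSocle_isMulComm : IsMulCommutative (aSocle G) :=
  ⟨⟨fun a b => Subtype.ext (Subgroup.mem_centralizer_iff.mp (aSocle_comm b.2) a a.2)⟩⟩

theorem sup_le_centralizer (s : Finset (Subgroup G)) (hs : ∀ M ∈ s, NonAb M) {N : Subgroup G}
    (hN : NonAb N) (h : N ∉ s) : s.sup id ≤ Subgroup.centralizer (N : Set G) := by
  refine Finset.sup_le ?_
  intro M hM
  refine le_centralizer_of_ne (hs M hM).1 hN.1 ?_
  rintro rfl
  exact h hM

theorem sup_normal (s : Finset (Subgroup G)) (hs : ∀ M ∈ s, NonAb M) : (s.sup id).Normal := by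
  classical
  induction s using Finset.induction_on with
  | empty => simp
  | insert N s hN ih =>
    rw [Finset.sup_insert]
    have := ih (fun M hM => hs M (Finset.mem_insert_of_mem hM))
    have : (id N : Subgroup G).Normal := (hs N (Finset.mem_insert_self _ _)).1.1
    exact Subgroup.sup_normal _ _

theorem sup_centerless (s : Finset (Subgroup G)) (hs : ∀ M ∈ s, NonAb M) (x : G)
    (hx : x ∈ s.sup id) (hc : ∀ M ∈ s, x ∈ Subgroup.centralizer (M : Set G)) : x = 1 := by
  classical
  induction s using Finset.induction_on generalizing x with
  | empty => simpa using hx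
  | insert N s hN ih =>
    have hs' : ∀ M ∈ s, NonAb M := fun M hM => hs M (Finset.mem_insert_of_mem hM)
    have hNn := hs N (Finset.mem_insert_self _ _)
    have := hNn.1.1
    rw [Finset.sup_insert, id, Subgroup.mem_sup_of_normal_left] at hx
    obtain ⟨n, hn, y, hy, rfl⟩ := hx
    have hy1 : y = 1 := by
      refine ih hs' y hy ?_
      intro M hM
      have h1 := hc M (Finset.mem_insert_of_mem hM)
      have h2 : n ∈ Subgroup.centralizer (M : Set G) :=
        le_centralizer_of_ne hNn.1 (hs' M hM).1 (by rintro rfl; exact hN hM) hn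
      exact (Subgroup.mul_mem_cancel_left _ h2).mp h1
    subst hy1
    rw [mul_one] at hc ⊢
    exact eq_one_of_nonAb hNn hn (hc N (Finset.mem_insert_self _ _))

theorem exists_nowhere_central (s : Finset (Subgroup G)) (hs : ∀ M ∈ s, NonAb M) :
    ∃ t ∈ s.sup id, ∀ M ∈ s, t ∉ Subgroup.centralizer (M : Set G) := by
  classical
  induction s using Finset.induction_on with
  | empty => exact ⟨1, by simp, by simp⟩
  | insert N s hN ih =>
    have hs' : ∀ M ∈ s, NonAb M := fun M hM => hs M (Finset.mem_insert_of_mem hM)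
    have hNn := hs N (Finset.mem_insert_self _ _)
    obtain ⟨t, ht, htc⟩ := ih hs'
    obtain ⟨n, hn, hn1⟩ := (Subgroup.ne_bot_iff_exists_ne_one.mp hNn.1.2.1 :
      ∃ a : N, a ≠ 1) |>.elim (fun a ha => ⟨a.1, a.2, fun h => ha (Subtype.ext h)⟩)
      |> (fun h : ∃ n, ∃ _ : n ∈ N, n ≠ 1 => h)
    refine ⟨t * n, ?_, ?_⟩
    · rw [Finset.sup_insert]
      exact Subgroup.mul_mem _ ((le_sup_right : s.sup id ≤ _) ht) ((le_sup_left : N ≤ _) hn)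
    · intro M hM hc
      rcases Finset.mem_insert.mp hM with rfl | hM
      · have h1 := sup_le_centralizer s hs' hNn hN ht
        exact hn1 (eq_one_of_nonAb hNn hn ((Subgroup.mul_mem_cancel_left _ h1).mp hc))
      · have h2 : n ∈ Subgroup.centralizer (M : Set G) :=
          le_centralizer_of_ne hNn.1 (hs' M hM).1 (by rintro rfl; exact hN hM) hn
        exact htc M hM ((Subgroup.mul_mem_cancel_right _ h2).mp hc)

section
variable (G) [Finite G]

/-- The finite set of all nonabelian minimal normal subgroups. -/
noncomputable def nonAbs : Finset (Subgroup G) := (Set.toFinite {N : Subgroup G | NonAb N}).toFinset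

variable {G} in
theorem mem_nonAbs {N : Subgroup G} : N ∈ nonAbs G ↔ NonAb N := by simp [nonAbs]

theorem socle_eq : socle G = aSocle G ⊔ (nonAbs G).sup id := by
  apply le_antisymm
  · refine sSup_le ?_
    intro M hM
    by_cases h : ∀ x ∈ M, ∀ y ∈ M, x * y = y * x
    · exact le_sup_of_le_left (le_sSup ⟨hM, h⟩)
    · exact le_sup_of_le_right (Finset.le_sup (f := id) (mem_nonAbs.mpr ⟨hM, h⟩))
  · refine sup_le (sSup_le_sSup fun M hM => hM.1) (Finset.sup_le fun M hM => ?_)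
    exact le_sSup (mem_nonAbs.mp hM).1

theorem aSocle_inf : ∀ x ∈ aSocle G, x ∈ (nonAbs G).sup id → x = 1 := by
  intro x hx hx'
  refine sup_centerless _ (fun M hM => mem_nonAbs.mp hM) x hx' ?_
  intro M hM
  exact aSocle_le_centralizer (mem_nonAbs.mp hM) hx

theorem normallyKGenerated_iff (k : ℕ) (hk : 1 ≤ k) :
    NormallyKGenerated (socle G) k ↔ NormallyKGenerated (aSocle G) k := by
  have hTn := sup_normal (nonAbs G) (fun M hM => mem_nonAbs.mp hM)
  set T := (nonAbs G).sup id with hT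
  have hSn : (socle G).Normal := by
    rw [socle_eq]
    exact Subgroup.sup_normal _ _
  constructor
  · rintro ⟨f, hf, hS⟩
    have h1 : ∀ i, ∃ a ∈ aSocle G, ∃ t ∈ T, a * t = f i := by
      intro i
      have := hf i
      rw [socle_eq, Subgroup.mem_sup_of_normal_left] at this
      exact this
    choose a ha t ht hat using h1
    refine ⟨a, ha, ?_⟩
    have hPA : Subgroup.normalClosure (Set.range a) ≤ aSocle G :=
      Subgroup.normalClosure_le_normal (by rintro _ ⟨i, rfl⟩; exact ha i)
    refine le_antisymm hPA ?_
    have hPT : socle G ≤ Subgroup.normalClosure (Set.range a) ⊔ T := by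
      rw [← hS]
      refine Subgroup.normalClosure_le_normal ?_
      rintro _ ⟨i, rfl⟩
      rw [← hat]
      exact Subgroup.mul_mem _
        ((le_sup_left : Subgroup.normalClosure (Set.range a) ≤ _)
          (Subgroup.subset_normalClosure ⟨i, rfl⟩)) ((le_sup_right : T ≤ _) (ht i))
    intro x hx
    have hxS : x ∈ socle G := by
      rw [socle_eq]
      exact (le_sup_left : aSocle G ≤ _) hx
    have := hPT hxS
    rw [Subgroup.mem_sup_of_normal_left] at this
    obtain ⟨p, hp, t, ht, rfl⟩ := this
    have : t = 1 := aSocle_inf G t ((Subgroup.mul_mem_cancel_left _ (hPA hp)).mp hx) ht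
    rw [this, mul_one]
    exact hp
  · rintro ⟨a, ha, hA⟩
    obtain ⟨t, ht, htc⟩ := exists_nowhere_central (nonAbs G) (fun M hM => mem_nonAbs.mp hM)
    let i0 : Fin k := ⟨0, hk⟩
    let f : Fin k → G := fun i => if i = i0 then a i * t else a i
    have hAS : aSocle G ≤ socle G := by rw [socle_eq]; exact le_sup_left
    have hTS : T ≤ socle G := by rw [socle_eq]; exact le_sup_right
    have hf : ∀ i, f i ∈ socle G := by
      intro i
      by_cases h : i = i0
      · simp only [f, if_pos h]
        exact Subgroup.mul_mem _ (hAS (ha i)) (hTS ht)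
      · simp only [f, if_neg h]
        exact hAS (ha i)
    refine ⟨f, hf, ?_⟩
    set P := Subgroup.normalClosure (Set.range f) with hP
    have hmem : ∀ i, f i ∈ P := fun i => Subgroup.subset_normalClosure ⟨i, rfl⟩
    refine le_antisymm (Subgroup.normalClosure_le_normal
      (by rintro _ ⟨i, rfl⟩; exact hf i)) ?_
    have hTP : T ≤ P := by
      refine Finset.sup_le ?_
      intro N hN
      have hNn := mem_nonAbs.mp hN
      have hNnorm := hNn.1.1
      have h1 : a i0 * t ∈ P := by simpa [f] using hmem i0
      have h2 : a i0 * t ∉ Subgroup.centralizer (N : Set G) := fun h =>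
        htc N hN ((Subgroup.mul_mem_cancel_left _ (aSocle_le_centralizer hNn (ha i0))).mp h)
      have hne : N ⊓ P ≠ ⊥ := by
        intro hb
        apply h2
        rw [Subgroup.mem_centralizer_iff]
        intro y hy
        exact (Subgroup.commute_of_normal_of_disjoint N P hNnorm inferInstance
          (disjoint_iff.mpr hb) y _ hy h1)
      have := hNn.1.2.2 (N ⊓ P) inferInstance hne inf_le_left
      rw [id, ← this]
      exact inf_le_right
    have hAP : aSocle G ≤ P := by
      rw [← hA]
      refine Subgroup.normalClosure_le_normal ?_
      rintro _ ⟨i, rfl⟩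
      have := hmem i
      by_cases h : i = i0
      · simp only [f, if_pos h] at this
        exact (Subgroup.mul_mem_cancel_right _ (hTP ht)).mp this
      · simp only [f, if_neg h] at this
        exact this
    rw [socle_eq]
    exact sup_le hAP hTP

end

/-- A nonabelian minimal normal subgroup contains an element whose order is a prime that
is not the characteristic. -/
theorem exists_prime_order [Finite G] {N : Subgroup G} (hN : NonAb N) (ℓ : ℕ) :
    ∃ g ∈ N, (orderOf g).Prime ∧ orderOf g ≠ ℓ := by
  have hnb : Nontrivial N := (Subgroup.nontrivial_iff_ne_bot N).mpr hN.1.2.1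
  by_contra hcon
  push Not at hcon
  have hall : ∀ p : ℕ, p.Prime → p ∣ Nat.card N → p = ℓ := by
    intro p hp hd
    have := Fact.mk hp
    obtain ⟨x, hx⟩ := exists_prime_orderOf_dvd_card' p hd
    have h1 : orderOf (x : G) = p := by rw [Subgroup.orderOf_coe, hx]
    have := hcon x x.2 (by rw [h1]; exact hp)
    rw [← this, h1]
  have hc1 : Nat.card N ≠ 1 := (Finite.one_lt_card).ne'
  have hℓ : ℓ.Prime := by
    have := hall _ (Nat.minFac_prime hc1) (Nat.minFac_dvd _)
    rw [← this]
    exact Nat.minFac_prime hc1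
  have := Fact.mk hℓ
  have hp : IsPGroup ℓ N := by
    rw [IsPGroup.iff_card]
    exact ⟨_, Nat.eq_prime_pow_of_unique_prime_dvd Nat.card_pos.ne' (fun {d} h1 h2 => hall d h1 h2)⟩
  have hnc := hp.center_nontrivial
  obtain ⟨z, hz⟩ := exists_ne (1 : Subgroup.center N)
  apply hz
  apply Subtype.ext
  apply Subtype.ext
  refine eq_one_of_nonAb hN z.1.2 ?_
  rw [Subgroup.mem_centralizer_iff]
  intro y hy
  have := Subgroup.mem_center_iff.mp z.2 ⟨y, hy⟩
  exact congrArg Subtype.val this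

/-- Construction of the abelian group `B` and its character. -/
theorem exists_B [Finite G] (ℓ : ℕ) (K : Type) [Field K] [IsAlgClosed K] [CharP K ℓ]
    (χ : aSocle G →* Kˣ) (s : Finset (Subgroup G)) (hs : ∀ M ∈ s, NonAb M) :
    ∃ (B : Type) (_ : CommGroup B) (_ : Finite B) (ι : B →* G) (ψ : B →* Kˣ),
      Function.Injective ι ∧ ι.range ≤ aSocle G ⊔ s.sup id ∧
      (∀ a : aSocle G, ∃ b, ι b = a ∧ ψ b = χ a) ∧
      ∀ N ∈ s, ∃ b, ι b ∈ N ∧ ψ b ≠ 1 := by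
  classical
  induction s using Finset.induction_on with
  | empty =>
    exact ⟨aSocle G, inferInstance, inferInstance, (aSocle G).subtype, χ,
      Subtype.val_injective, by simp, fun a => ⟨a, rfl, rfl⟩, by simp⟩
  | insert N s hN ih =>
    have hs' : ∀ M ∈ s, NonAb M := fun M hM => hs M (Finset.mem_insert_of_mem hM)
    have hNn := hs N (Finset.mem_insert_self _ _)
    obtain ⟨B, iB, fB, ι, ψ, hι, hr, hA, hs2⟩ := ih hs'
    obtain ⟨g, hg, hgp, hgl⟩ := exists_prime_order hNn ℓ
    have hgN : Subgroup.zpowers g ≤ N := by rwa [Subgroup.zpowers_le]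
    have hcen : aSocle G ⊔ s.sup id ≤ Subgroup.centralizer (N : Set G) :=
      sup_le (aSocle_le_centralizer hNn) (sup_le_centralizer s hs' hNn hN)
    have hcard : Nat.card (Subgroup.zpowers g) = orderOf g := Nat.card_zpowers g
    have hK : ((Nat.card (Subgroup.zpowers g) : ℕ) : K) ≠ 0 := by
      rw [hcard, Ne, CharP.cast_eq_zero_iff K ℓ]
      intro hd
      rcases (Nat.dvd_prime hgp).mp hd with h | h
      · exact CharP.char_ne_one K ℓ h
      · exact hgl h.symm
    have : NeZero ((Monoid.exponent (Subgroup.zpowers g) : ℕ) : K) := ⟨by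
      intro h
      apply hK
      obtain ⟨c, hc⟩ := Group.exponent_dvd_nat_card (G := Subgroup.zpowers g)
      rw [hc, Nat.cast_mul, h, zero_mul]⟩
    have hg1 : (⟨g, Subgroup.mem_zpowers g⟩ : Subgroup.zpowers g) ≠ 1 := by
      intro h
      have : g = 1 := congrArg Subtype.val h
      rw [this, orderOf_one] at hgp
      exact Nat.not_prime_one hgp
    obtain ⟨θ, hθ⟩ := CommGroup.exists_apply_ne_one_of_hasEnoughRootsOfUnity
      (Subgroup.zpowers g) K hg1
    have hcomm : ∀ (b : B) (z : Subgroup.zpowers g), Commute (ι b) ((Subgroup.zpowers g).subtype z) :=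
      fun b z => (Subgroup.mem_centralizer_iff.mp (hcen (hr ⟨b, rfl⟩)) z (hgN z.2)).symm
    refine ⟨B × Subgroup.zpowers g, inferInstance, inferInstance,
      MonoidHom.noncommCoprod ι (Subgroup.zpowers g).subtype hcomm, ψ.coprod θ, ?_, ?_, ?_, ?_⟩
    · rw [MonoidHom.noncommCoprod_injective]
      refine ⟨hι, Subtype.val_injective, ?_⟩
      rw [disjoint_iff, eq_bot_iff]
      rintro x ⟨hx1, hx2⟩
      have hx2' : x ∈ Subgroup.zpowers g := by simpa using hx2
      exact eq_one_of_nonAb hNn (hgN hx2') (hcen (hr hx1))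
    · rintro _ ⟨⟨b, z⟩, rfl⟩
      rw [MonoidHom.noncommCoprod_apply, Finset.sup_insert, id]
      refine Subgroup.mul_mem _ ?_ ?_
      · have h1 := hr ⟨b, rfl⟩
        exact (sup_le_sup_left le_sup_right _ : aSocle G ⊔ s.sup id ≤ _) h1
      · exact (le_sup_of_le_right le_sup_left : N ≤ _) (hgN z.2)
    · intro a
      obtain ⟨b, hb1, hb2⟩ := hA a
      exact ⟨(b, 1), by simp [hb1], by simp [hb2]⟩
    · intro M hM
      rcases Finset.mem_insert.mp hM with rfl | hM
      · exact ⟨(1, ⟨g, Subgroup.mem_zpowers g⟩), by simpa using hg, by simpa using hθ⟩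
      · obtain ⟨b, hb1, hb2⟩ := hs2 M hM
        exact ⟨(b, 1), by simpa using hb1, by simpa using hb2⟩

end GroupPart
end Zmud
namespace Zmud
section Bridge
open scoped IsMulCommutative
open MonoidAlgebra

variable {G : Type} [Group G]

/-- The submodule attached to a normal subgroup. -/
noncomputable def toSub {X : Type} [AddCommGroup X] [Module (MonoidAlgebra ℤ G) X]
    (val : Multiplicative X →* G)
    (hval : ∀ g x, val (Multiplicative.ofAdd (of ℤ G g • x)) =
      g * val (Multiplicative.ofAdd x) * g⁻¹)
    (N : Subgroup G) (hN : N.Normal) : Submodule (MonoidAlgebra ℤ G) X where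
  carrier := {x | val (Multiplicative.ofAdd x) ∈ N}
  zero_mem' := by
    change val 1 ∈ N
    rw [map_one]; exact N.one_mem
  add_mem' := by
    intro x y hx hy
    change val (Multiplicative.ofAdd x * Multiplicative.ofAdd y) ∈ N
    rw [map_mul]; exact N.mul_mem hx hy
  smul_mem' := by
    intro r x hx
    change val (Multiplicative.ofAdd x) ∈ N at hx
    change val (Multiplicative.ofAdd (r • x)) ∈ N
    induction r using MonoidAlgebra.induction_on with
    | of g => rw [hval]; exact hN.conj_mem _ hx g
    | add a b ha hb =>
      rw [add_smul, ofAdd_add, map_mul]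
      exact N.mul_mem ha hb
    | smul c a ha =>
      rw [zsmul_eq_mul, mul_smul, Int.cast_smul_eq_zsmul, ofAdd_zsmul, map_zpow]
      exact N.zpow_mem ha c

/-- The normal subgroup attached to a submodule. -/
noncomputable def ofSub {X : Type} [AddCommGroup X] [Module (MonoidAlgebra ℤ G) X]
    (val : Multiplicative X →* G) (P : Submodule (MonoidAlgebra ℤ G) X) : Subgroup G :=
  (AddSubgroup.toSubgroup P.toAddSubgroup).map val

theorem mem_ofSub {X : Type} [AddCommGroup X] [Module (MonoidAlgebra ℤ G) X]
    (val : Multiplicative X →* G) (P : Submodule (MonoidAlgebra ℤ G) X) (g : G) :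
    g ∈ ofSub val P ↔ ∃ x ∈ P, val (Multiplicative.ofAdd x) = g := Iff.rfl

theorem ofSub_normal {X : Type} [AddCommGroup X] [Module (MonoidAlgebra ℤ G) X]
    (val : Multiplicative X →* G)
    (hval : ∀ g x, val (Multiplicative.ofAdd (of ℤ G g • x)) =
      g * val (Multiplicative.ofAdd x) * g⁻¹)
    (P : Submodule (MonoidAlgebra ℤ G) X) : (ofSub val P).Normal := by
  constructor
  intro n hn g
  rw [mem_ofSub] at hn ⊢
  obtain ⟨x, hx, rfl⟩ := hn
  exact ⟨of ℤ G g • x, P.smul_mem _ hx, hval g x⟩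

theorem exists_model (A : Subgroup G) [A.Normal] [IsMulCommutative A] :
    ∃ (X : Type) (_ : AddCommGroup X) (_ : Module (MonoidAlgebra ℤ G) X)
      (e : Multiplicative X ≃* A), ∀ g x, (e (Multiplicative.ofAdd (of ℤ G g • x)) : G) =
      g * e (Multiplicative.ofAdd x) * g⁻¹ := by
  let ρ : Representation ℤ G (Additive A) :=
    { toFun := fun g => (MonoidHom.toAdditive (MulAut.conjNormal (H := A) g).toMonoidHom).toIntLinearMap
      map_one' := by ext; simp
      map_mul' := by intro g h; ext; simp }
  let e : Multiplicative ρ.asModule ≃* A :=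
    { toFun := fun x => (ρ.asModuleEquiv x.toAdd).toMul
      invFun := fun a => Multiplicative.ofAdd (ρ.asModuleEquiv.symm (Additive.ofMul a))
      left_inv := fun x => by simp
      right_inv := fun x => by simp
      map_mul' := fun x y => by simp }
  refine ⟨ρ.asModule, inferInstance, inferInstance, e, ?_⟩
  intro g x
  change ((ρ.asModuleEquiv (of ℤ G g • x)).toMul : G) = g * (ρ.asModuleEquiv x).toMul * g⁻¹
  rw [Representation.asModuleEquiv_map_smul, Representation.asAlgebraHom_of]
  simp [ρ]

theorem bridge [Finite G] (ℓ : ℕ) (K : Type) [Field K] [IsAlgClosed K] [CharP K ℓ] (k : ℕ)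
    (hℓ : ¬ ℓ ∣ Nat.card (aSocle G)) :
    NormallyKGenerated (aSocle G) k ↔ ∃ χ : Fin k → (aSocle G →* Kˣ),
      ∀ N : Subgroup G, N.Normal → N ≤ aSocle G →
        (∀ i, ∀ a : aSocle G, (a : G) ∈ N → χ i a = 1) → N = ⊥ := by
  obtain ⟨X, iX, mX, e, he⟩ := exists_model (aSocle G)
  let val : Multiplicative X →* G := (aSocle G).subtype.comp e.toMonoidHom
  have hval : ∀ g x, val (Multiplicative.ofAdd (of ℤ G g • x)) =
      g * val (Multiplicative.ofAdd x) * g⁻¹ := he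
  have hvale : ∀ x, val x = e x := fun _ => rfl
  have hinj : Function.Injective val := Subtype.val_injective.comp e.injective
  have hmemA : ∀ x, val x ∈ aSocle G := fun x => (e x).2
  have hsurj : ∀ g ∈ aSocle G, ∃ x, val (Multiplicative.ofAdd x) = g := fun g hg =>
    ⟨(e.symm ⟨g, hg⟩).toAdd, by simp [hvale]⟩
  have hfin : Finite X := Finite.of_equiv _ (e.toEquiv.symm.trans Multiplicative.toAdd)
  have hcard : Nat.card X = Nat.card (aSocle G) :=
    Nat.card_congr (Multiplicative.ofAdd.trans e.toEquiv)
  have hmem_toSub : ∀ N hN x, x ∈ toSub val hval N hN ↔ val (Multiplicative.ofAdd x) ∈ N :=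
    fun _ _ _ => Iff.rfl
  -- an `ofSub` of a nonzero submodule is nontrivial
  have hofSub_ne : ∀ P : Submodule (MonoidAlgebra ℤ G) X, ofSub val P = ⊥ → P = ⊥ := by
    intro P hP
    rw [eq_bot_iff]
    intro x hx
    have h1 : val (Multiplicative.ofAdd x) ∈ ofSub val P := (mem_ofSub _ _ _).mpr ⟨x, hx, rfl⟩
    rw [hP, Subgroup.mem_bot, ← map_one val] at h1
    exact Multiplicative.ofAdd.injective (hinj h1)
  have hss : IsSemisimpleModule (MonoidAlgebra ℤ G) X := by
    apply IsSemisimpleModule.of_sSup_simples_eq_top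
    set P := sSup {m : Submodule (MonoidAlgebra ℤ G) X | IsSimpleModule (MonoidAlgebra ℤ G) m}
      with hP
    have hle : aSocle G ≤ ofSub val P := by
      refine sSup_le ?_
      rintro N ⟨hN, hNc⟩
      have hNA : N ≤ aSocle G := le_sSup ⟨hN, hNc⟩
      have hsimple : IsSimpleModule (MonoidAlgebra ℤ G) (toSub val hval N hN.1) := by
        rw [isSimpleModule_iff_isAtom]
        constructor
        · intro hb
          apply hN.2.1
          rw [eq_bot_iff]
          intro g hg
          obtain ⟨x, rfl⟩ := hsurj g (hNA hg)
          have : x ∈ toSub val hval N hN.1 := hg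
          rw [hb, Submodule.mem_bot] at this
          subst this
          exact map_one val
        · intro Q hQ
          by_contra hQb
          have h1 : ofSub val Q ≤ N := by
            rintro g hg
            obtain ⟨x, hx, rfl⟩ := (mem_ofSub _ _ _).mp hg
            exact hQ.le hx
          have h2 := hN.2.2 _ (ofSub_normal val hval Q) (fun h => hQb (hofSub_ne Q h)) h1
          apply hQ.not_ge
          intro x hx
          have h3 : val (Multiplicative.ofAdd x) ∈ ofSub val Q := by rw [h2]; exact hx
          obtain ⟨y, hy, hxy⟩ := (mem_ofSub _ _ _).mp h3
          have : y = x := Multiplicative.ofAdd.injective (hinj hxy)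
          rwa [← this]
      have hle' : toSub val hval N hN.1 ≤ P := le_sSup hsimple
      intro g hg
      obtain ⟨x, rfl⟩ := hsurj g (hNA hg)
      exact (mem_ofSub _ _ _).mpr ⟨x, hle' hg, rfl⟩
    rw [eq_top_iff]
    intro x _
    obtain ⟨y, hy, hxy⟩ := (mem_ofSub _ _ _).mp (hle (hmemA (Multiplicative.ofAdd x)))
    have : y = x := Multiplicative.ofAdd.injective (hinj hxy)
    rwa [← this]
  have hD : ∀ (M : Type) [AddCommGroup M], Finite M → Nat.card M ∣ Nat.card X →
      Nat.card (M →+ Additive Kˣ) = Nat.card M := by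
    intro M _ _ hM
    have hK : ((Nat.card M : ℕ) : K) ≠ 0 := by
      rw [Ne, CharP.cast_eq_zero_iff K ℓ]
      intro hd
      exact hℓ (hcard ▸ hd.trans hM)
    have : NeZero ((Monoid.exponent (Multiplicative M) : ℕ) : K) := ⟨by
      intro h
      apply hK
      obtain ⟨c, hc⟩ := Group.exponent_dvd_nat_card (G := Multiplicative M)
      have hc' : Nat.card M = Monoid.exponent (Multiplicative M) * c := hc
      rw [hc', Nat.cast_mul, h, zero_mul]⟩
    have h1 := CommGroup.card_monoidHom_of_hasEnoughRootsOfUnity (Multiplicative M) K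
    rw [Nat.card_congr (MonoidHom.toAdditiveRight (α := M) (β := Kˣ)).symm]
    exact h1
  have key := span_iff_chars (R := MonoidAlgebra ℤ G) (D := Additive Kˣ) k X hD
  constructor
  · rintro ⟨f, hf, hfA⟩
    obtain ⟨χ, hχ⟩ := key.mp (by
      choose x hx using fun i => hsurj (f i) (hf i)
      refine ⟨x, ?_⟩
      set P := Submodule.span (MonoidAlgebra ℤ G) (Set.range x)
      have hn := ofSub_normal val hval P
      have hle : aSocle G ≤ ofSub val P := by
        rw [← hfA]
        refine Subgroup.normalClosure_le_normal ?_
        rintro _ ⟨i, rfl⟩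
        exact (mem_ofSub _ _ _).mpr ⟨x i, Submodule.subset_span ⟨i, rfl⟩, hx i⟩
      rw [eq_top_iff]
      intro x _
      obtain ⟨y, hy, hxy⟩ := (mem_ofSub _ _ _).mp (hle (hmemA (Multiplicative.ofAdd x)))
      have : y = x := Multiplicative.ofAdd.injective (hinj hxy)
      rwa [← this])
    refine ⟨fun i => (MonoidHom.toAdditiveRight.symm (χ i)).comp e.symm.toMonoidHom, ?_⟩
    intro N hN hNA hker
    have h1 := hχ (toSub val hval N hN) (by
      intro i x hx
      have h2 := hker i (e (Multiplicative.ofAdd x)) hx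
      simpa using h2)
    rw [eq_bot_iff]
    intro g hg
    obtain ⟨x, rfl⟩ := hsurj g (hNA hg)
    have : x ∈ toSub val hval N hN := hg
    rw [h1, Submodule.mem_bot] at this
    subst this
    exact map_one val
  · rintro ⟨χ, hχ⟩
    obtain ⟨f, hf⟩ := key.mpr (by
      refine ⟨fun i => MonoidHom.toAdditiveRight ((χ i).comp e.toMonoidHom), ?_⟩
      intro P hP
      apply hofSub_ne
      apply hχ _ (ofSub_normal val hval P)
      · intro g hg
        obtain ⟨x, hx, rfl⟩ := (mem_ofSub _ _ _).mp hg
        exact hmemA _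
      · intro i a ha
        obtain ⟨x, hx, hxa⟩ := (mem_ofSub _ _ _).mp ha
        have h1 : e (Multiplicative.ofAdd x) = a := Subtype.ext hxa
        have h2 := hP i x hx
        rw [← h1]
        exact h2)
    refine ⟨fun i => val (Multiplicative.ofAdd (f i)), fun i => hmemA _, ?_⟩
    set Q := Subgroup.normalClosure (Set.range fun i => val (Multiplicative.ofAdd (f i))) with hQ
    refine le_antisymm (Subgroup.normalClosure_le_normal
      (by rintro _ ⟨i, rfl⟩; exact hmemA _)) ?_
    have hQn : Q.Normal := Subgroup.normalClosure_normal
    have h1 : toSub val hval Q hQn = ⊤ := by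
      rw [eq_top_iff, ← hf, Submodule.span_le]
      rintro _ ⟨i, rfl⟩
      exact Subgroup.subset_normalClosure (s := Set.range fun i => val (Multiplicative.ofAdd (f i))) ⟨i, rfl⟩
    intro g hg
    obtain ⟨x, rfl⟩ := hsurj g hg
    have : x ∈ toSub val hval Q hQn := by rw [h1]; trivial
    exact this

end Bridge
end Zmud
namespace Zmud
section Final
open scoped IsMulCommutative
open MonoidAlgebra

variable {G : Type} [Group G] {F : Type} [Field F]

/-- A finite-dimensional module over the group algebra is realised on coordinate space. -/
lemma realize (M : Type) [AddCommGroup M] [Module F M] [Module (MonoidAlgebra F G) M]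
    [IsScalarTower F (MonoidAlgebra F G) M] [Module.Finite F M] :
    ∃ (n : ℕ) (ρ : Representation F G (Fin n → F)),
      Nonempty (ρ.asModule ≃ₗ[MonoidAlgebra F G] M) := by
  let e : M ≃ₗ[F] (Fin (Module.finrank F M) → F) := (Module.finBasis F M).equivFun
  let a : MonoidAlgebra F G →ₐ[F] Module.End F M := Algebra.lsmul F F M
  let c : Module.End F M ≃ₐ[F] Module.End F (Fin (Module.finrank F M) → F) := e.conjAlgEquiv F
  let ρ : Representation F G (Fin (Module.finrank F M) → F) :=
    (MonoidAlgebra.lift F _ G).symm (c.toAlgHom.comp a)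
  have hρ : ρ.asAlgebraHom = c.toAlgHom.comp a := by
    rw [Representation.asAlgebraHom_def]
    exact (MonoidAlgebra.lift F _ G).apply_symm_apply _
  refine ⟨_, ρ, ⟨?_⟩⟩
  refine { (ρ.asModuleEquiv.trans e.symm).toAddEquiv with map_smul' := ?_ }
  intro r x
  change e.symm (ρ.asModuleEquiv (r • x)) = r • e.symm (ρ.asModuleEquiv x)
  rw [Representation.asModuleEquiv_map_smul, hρ]
  change e.symm (e (r • e.symm (ρ.asModuleEquiv x))) = _
  rw [e.symm_apply_apply]

lemma isInternal_transport {R : Type} [Ring R] {k : ℕ} (V : Fin k → Type)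
    [∀ i, AddCommGroup (V i)] [∀ i, Module R (V i)] [∀ i, IsSimpleModule R (V i)]
    {X : Type} [AddCommGroup X] [Module R X] (e : X ≃ₗ[R] (∀ i, V i)) :
    ∃ W : Fin k → Submodule R X, (∀ i, IsSimpleModule R (W i)) ∧ DirectSum.IsInternal W := by
  let f : ∀ i, V i →ₗ[R] X := fun i => e.symm.toLinearMap ∘ₗ LinearMap.single R V i
  have hf : ∀ i, Function.Injective (f i) := fun i =>
    e.symm.injective.comp (Pi.single_injective i)
  refine ⟨fun i => LinearMap.range (f i), fun i => ?_, ?_⟩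
  · exact IsSimpleModule.congr (LinearEquiv.ofInjective (f i) (hf i)).symm
  · rw [DirectSum.isInternal_submodule_iff_iSupIndep_and_iSup_eq_top]
    constructor
    · intro i
      rw [Submodule.disjoint_def]
      rintro x ⟨v, rfl⟩ hx
      have hle : (⨆ j, ⨆ (_ : j ≠ i), LinearMap.range (f j)) ≤
          LinearMap.ker (LinearMap.proj i ∘ₗ e.toLinearMap) := by
        refine iSup₂_le fun j hj => ?_
        rintro _ ⟨w, rfl⟩
        simp [f, Pi.single_eq_of_ne hj.symm]
      have := hle hx
      simp [f] at this
      rw [this, map_zero]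
    · rw [eq_top_iff]
      intro x _
      have hx : x = ∑ i, f i (e x i) := by
        apply e.injective
        rw [map_sum]
        simp only [f, LinearMap.comp_apply, LinearEquiv.coe_coe, LinearEquiv.apply_symm_apply]
        exact (LinearMap.sum_single_apply (φ := V) (v := e x)).symm
      rw [hx]
      exact Submodule.sum_mem _ fun i _ =>
        Submodule.mem_iSup_of_mem i ⟨_, rfl⟩

/-- The kernel of the action on a module. -/
def actKer (F : Type) [Field F] (M : Type) [AddCommGroup M] [Module (MonoidAlgebra F G) M] :
    Subgroup G where
  carrier := {g | ∀ m : M, MonoidAlgebra.of F G g • m = m}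
  one_mem' := by intro m; rw [map_one, one_smul]
  mul_mem' := by
    intro a b ha hb m
    rw [map_mul, mul_smul, hb, ha]
  inv_mem' := by
    intro a ha m
    conv_lhs => rw [← ha m]
    rw [← mul_smul, ← map_mul, inv_mul_cancel, map_one, one_smul]

lemma mem_actKer {M : Type} [AddCommGroup M] [Module (MonoidAlgebra F G) M] (g : G) :
    g ∈ actKer F M ↔ ∀ m : M, MonoidAlgebra.of F G g • m = m := Iff.rfl

lemma actKer_normal (M : Type) [AddCommGroup M] [Module (MonoidAlgebra F G) M] :
    (actKer (G := G) F M).Normal := by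
  constructor
  intro n hn g m
  rw [map_mul, map_mul, mul_smul, mul_smul, hn, ← mul_smul, ← map_mul, mul_inv_cancel,
    map_one, one_smul]

lemma rho_trivial_iff {n : ℕ} (ρ : Representation F G (Fin n → F)) (g : G) :
    (∀ v, ρ g v = v) ↔ g ∈ actKer F ρ.asModule := by
  rw [mem_actKer]
  constructor
  · intro h m
    have := ρ.asModuleEquiv_symm_map_rho g (ρ.asModuleEquiv m)
    rw [h] at this
    simpa using this.symm
  · intro h v
    apply ρ.asModuleEquiv.symm.injective
    rw [ρ.asModuleEquiv_symm_map_rho, h]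

lemma forward [Finite G] (ℓ : ℕ) [CharP F ℓ] (k : ℕ) (hk : 1 ≤ k)
    (hℓ : ¬ (ℓ ∣ Nat.card ↥(aSocle G))) (hgen : NormallyKGenerated (socle G) k) :
    ∃ (n : ℕ) (ρ : Representation F G (Fin n → F)),
        (∀ g : G, (∀ v : Fin n → F, ρ g v = v) → g = 1) ∧
        ∃ W : Fin k → Submodule (MonoidAlgebra F G) ρ.asModule,
          (∀ i, IsSimpleModule (MonoidAlgebra F G) ↥(W i)) ∧
          DirectSum.IsInternal W := by
  haveI : CharP (AlgebraicClosure F) ℓ :=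
    charP_of_injective_algebraMap (algebraMap F (AlgebraicClosure F)).injective ℓ
  rw [normallyKGenerated_iff G k hk, bridge ℓ (AlgebraicClosure F) k hℓ] at hgen
  obtain ⟨χ, hχ⟩ := hgen
  have key : ∀ i, ∃ L : Submodule (MonoidAlgebra F G) (MonoidAlgebra F G),
      IsSimpleModule (MonoidAlgebra F G) (MonoidAlgebra F G ⧸ L) ∧
      (∀ a : aSocle G, χ i a ≠ 1 →
        ∃ w : MonoidAlgebra F G ⧸ L, MonoidAlgebra.of F G (a : G) • w ≠ w) ∧
      (∀ N : Subgroup G, NonAb N → ∃ b ∈ N,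
        ∃ w : MonoidAlgebra F G ⧸ L, MonoidAlgebra.of F G b • w ≠ w) := by
    intro i
    obtain ⟨B, _, _, ι, ψ, hι, -, h1, h2⟩ := exists_B ℓ (AlgebraicClosure F) (χ i) (nonAbs G)
      (fun M hM => mem_nonAbs.1 hM)
    obtain ⟨L, hL, hL2⟩ := exists_simple_of_char (F := F) (AlgebraicClosure F) B ι hι ψ
    refine ⟨L, hL, ?_, ?_⟩
    · intro a ha
      obtain ⟨b, hb, hb2⟩ := h1 a
      rw [← hb]
      exact hL2 b (hb2 ▸ ha)
    · intro N hN
      obtain ⟨b, hb, hb2⟩ := h2 N (mem_nonAbs.2 hN)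
      exact ⟨ι b, hb, hL2 b hb2⟩
  choose L hL hA hN using key
  let V : Fin k → Type := fun i => MonoidAlgebra F G ⧸ L i
  obtain ⟨n, ρ, ⟨e⟩⟩ := realize (F := F) (G := G) (∀ i, MonoidAlgebra F G ⧸ L i)
  refine ⟨n, ρ, ?_, isInternal_transport _ e⟩
  have hker : actKer (G := G) F ρ.asModule = ⊥ := by
    by_contra hne
    obtain ⟨N, hmin, hle⟩ := exists_minimalNormal_le _ (actKer_normal (F := F) (G := G) ρ.asModule) hne
    have htriv : ∀ g ∈ N, ∀ i, ∀ w : MonoidAlgebra F G ⧸ L i, MonoidAlgebra.of F G g • w = w := by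
      intro g hg i w
      have h := hle hg (e.symm (Pi.single i w))
      have h2 := congrArg e h
      rw [map_smul, e.apply_symm_apply] at h2
      have h3 := congrFun h2 i
      simpa using h3
    by_cases hab : ∀ x ∈ N, ∀ y ∈ N, x * y = y * x
    · have hNA : N ≤ aSocle G := le_sSup ⟨hmin, hab⟩
      refine hmin.2.1 (hχ N hmin.1 hNA ?_)
      intro i a ha
      by_contra hc
      obtain ⟨w, hw⟩ := hA i a hc
      exact hw (htriv _ ha i w)
    · obtain ⟨b, hb, w, hw⟩ := hN ⟨0, hk⟩ N ⟨hmin, hab⟩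
      exact hw (htriv b hb _ w)
  intro g hg
  have := (rho_trivial_iff ρ g).1 hg
  rw [hker] at this
  exact this

lemma backward [Finite G] (ℓ : ℕ) [CharP F ℓ] (k : ℕ) (hk : 1 ≤ k)
    {n : ℕ} (ρ : Representation F G (Fin n → F))
    (hf : ∀ g : G, (∀ v : Fin n → F, ρ g v = v) → g = 1)
    (W : Fin k → Submodule (MonoidAlgebra F G) ρ.asModule)
    (hW : ∀ i, IsSimpleModule (MonoidAlgebra F G) ↥(W i))
    (hI : DirectSum.IsInternal W) :
    ¬ (ℓ ∣ Nat.card ↥(aSocle G)) ∧ NormallyKGenerated (socle G) k := by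
  haveI : CharP (AlgebraicClosure F) ℓ :=
    charP_of_injective_algebraMap (algebraMap F (AlgebraicClosure F)).injective ℓ
  have key : ∀ i, ∃ χ : aSocle G →* (AlgebraicClosure F)ˣ, ∀ N : Subgroup G, N.Normal →
      (∀ n ∈ N, ∃ a, (aSocle G).subtype a = n ∧ χ a = 1) →
      ∀ n ∈ N, ∀ m : W i, MonoidAlgebra.of F G n • m = m := fun i =>
    haveI := hW i
    exists_char_of_simple (AlgebraicClosure F) (W i) (aSocle G) (aSocle G).subtype
  choose χ hχ using key
  have hfa : ∀ N : Subgroup G, N.Normal → N ≤ aSocle G →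
      (∀ i, ∀ a : aSocle G, (a : G) ∈ N → χ i a = 1) → N = ⊥ := by
    intro N hN hle h
    rw [eq_bot_iff]
    intro g hg
    refine hf g ((rho_trivial_iff ρ g).2 ?_)
    intro m
    have hm : m ∈ ⨆ i, W i := by rw [hI.submodule_iSup_eq_top]; trivial
    induction hm using Submodule.iSup_induction' with
    | mem i x hx =>
      have := hχ i N hN (fun n hn => ⟨⟨n, hle hn⟩, rfl, h i _ hn⟩) g hg ⟨x, hx⟩
      exact congrArg Subtype.val this
    | zero => rw [smul_zero]
    | add x y _ _ hx hy => rw [smul_add, hx, hy]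
  have hℓ : ¬ (ℓ ∣ Nat.card ↥(aSocle G)) := by
    intro hd
    have hpos : 0 < Nat.card ↥(aSocle G) := Nat.card_pos
    have hp : ℓ.Prime := by
      rcases CharP.char_is_prime_or_zero F ℓ with h | h
      · exact h
      · subst h
        rw [zero_dvd_iff] at hd
        omega
    haveI : Fact ℓ.Prime := ⟨hp⟩
    obtain ⟨a, ha⟩ := exists_prime_orderOf_dvd_card' ℓ hd
    let P : Subgroup G := ((powMonoidHom ℓ : aSocle G →* aSocle G).ker).map (aSocle G).subtype
    have hmem : ∀ x : aSocle G, (x : G) ∈ P ↔ x ^ ℓ = 1 := by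
      intro x
      constructor
      · rintro ⟨y, hy, hyx⟩
        have : y = x := Subtype.ext hyx
        rw [← this]
        exact hy
      · intro h
        exact ⟨x, h, rfl⟩
    have hPle : P ≤ aSocle G := by
      rintro _ ⟨y, -, rfl⟩
      exact y.2
    have hPn : P.Normal := by
      constructor
      intro x hx g
      have hxA := hPle hx
      have hn : (aSocle G).Normal := inferInstance
      have h1 := (hmem ⟨x, hxA⟩).1 hx
      refine (hmem ⟨g * x * g⁻¹, hn.conj_mem x hxA g⟩).2 ?_
      apply Subtype.ext
      have h2 : x ^ ℓ = 1 := congrArg Subtype.val h1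
      change (g * x * g⁻¹) ^ ℓ = 1
      rw [conj_pow, h2, mul_one, mul_inv_cancel]
    have hbot := hfa P hPn hPle (by
      intro i x hx
      have h1 := (hmem x).1 hx
      have h2 : (χ i x) ^ ℓ = 1 := by rw [← map_pow, h1, map_one]
      have h3 : ((χ i x : (AlgebraicClosure F)ˣ) : AlgebraicClosure F) ^ ℓ = 1 := by
        rw [← Units.val_pow_eq_pow_val, h2, Units.val_one]
      apply Units.ext
      apply frobenius_inj (AlgebraicClosure F) ℓ
      simpa [frobenius_def] using h3)
    have haP : (a : G) ∈ P := (hmem a).2 (by rw [← ha]; exact pow_orderOf_eq_one a)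
    rw [hbot, Subgroup.mem_bot] at haP
    have ha1 : a = 1 := Subtype.ext haP
    rw [ha1, orderOf_one] at ha
    exact hp.one_lt.ne ha
  refine ⟨hℓ, ?_⟩
  rw [normallyKGenerated_iff G k hk, bridge ℓ (AlgebraicClosure F) k hℓ]
  exact ⟨χ, hfa⟩

end Final
end Zmud

/-- Žmud's theorem, generalized: for a finite group `G`, a field `F` of characteristic
`ℓ` and `k ≥ 1`, the following are equivalent: (1) `ℓ ∤ |A(G)|` and `S(G)` is
`k`-generated as a normal subgroup of `G`; (2) `G` has a faithful completely reducible
representation over `F` with `k` irreducible constituents, i.e. there is an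
`F[G]`-module which is a direct sum of `k` simple modules and on which `G` acts
faithfully. -/
theorem zmud_theorem (G : Type) [Group G] [Finite G] (F : Type) [Field F]
    (ℓ : ℕ) [CharP F ℓ] (k : ℕ) (hk : 1 ≤ k) :
    (¬ (ℓ ∣ Nat.card ↥(aSocle G)) ∧ NormallyKGenerated (socle G) k) ↔
      (∃ (n : ℕ) (ρ : Representation F G (Fin n → F)),
        (∀ g : G, (∀ v : Fin n → F, ρ g v = v) → g = 1) ∧
        ∃ W : Fin k → Submodule (MonoidAlgebra F G) ρ.asModule,
          (∀ i, IsSimpleModule (MonoidAlgebra F G) ↥(W i)) ∧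
          DirectSum.IsInternal W) := by
  constructor
  · rintro ⟨hℓ, hgen⟩
    exact Zmud.forward ℓ k hk hℓ hgen
  · rintro ⟨n, ρ, hf, W, hW, hI⟩
    exact Zmud.backward ℓ k hk ρ hf W hW hI
end

section
/- (Gaschütz's theorem.) Let G be a finite group and F a field of characteristic ℓ. Then G has a faithful irreducible representation over F (i.e., there is a simple F[G]-module on which G acts faithfully) if and only if ℓ does not divide |A(G)| and the socle S(G) is generated as a normal subgroup of G by a single element. -/
variable {G : Type*} [Group G]

def SGen (R A : Type*) [Ring R] [AddCommGroup A] [Module R A] : Prop :=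
  ∃ a : A, ∀ b : A, ∃ r : R, r • a = b

def SDual (R A K : Type*) [Ring R] [AddCommGroup A] [Module R A] [Field K] : Prop :=
  ∃ χ : A →+ Additive Kˣ, ∀ N : Submodule R A, (∀ x ∈ N, χ x = 0) → N = ⊥

section duality
variable {R : Type*} [Ring R]

theorem SGen.congr {A B : Type*} [AddCommGroup A] [Module R A] [AddCommGroup B] [Module R B]
    (e : A ≃ₗ[R] B) (h : SGen R A) : SGen R B := by
  obtain ⟨a, ha⟩ := h
  refine ⟨e a, fun b => ?_⟩
  obtain ⟨r, hr⟩ := ha (e.symm b)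
  exact ⟨r, by rw [← map_smul, hr]; simp⟩

theorem SDual.congr {K : Type*} [Field K] {A B : Type*} [AddCommGroup A] [Module R A]
    [AddCommGroup B] [Module R B]
    (e : A ≃ₗ[R] B) (h : SDual R A K) : SDual R B K := by
  obtain ⟨χ, hχ⟩ := h
  refine ⟨χ.comp e.symm.toAddEquiv.toAddMonoidHom, fun N hN => ?_⟩
  have := hχ (N.comap e.toLinearMap) (fun x hx => by simpa using hN (e x) hx)
  rw [eq_bot_iff] at this ⊢
  intro y hy
  have h2 := this (show e.symm y ∈ N.comap e.toLinearMap by simpa using hy)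
  simpa using h2

theorem sgen_prod {B V : Type*} [AddCommGroup B] [Module R B] [AddCommGroup V] [Module R V]
    [Finite B] [Finite V] [IsSimpleModule R V] :
    SGen R (B × V) ↔ SGen R B ∧ Nat.card (B →ₗ[R] V) < Nat.card V := by
  have hnt : Nontrivial V := IsSimpleModule.nontrivial R V
  constructor
  · rintro ⟨⟨b, v⟩, h⟩
    have hb : ∀ b', ∃ r : R, r • b = b' := fun b' => by
      obtain ⟨r, hr⟩ := h (b', 0)
      exact ⟨r, (Prod.ext_iff.1 hr).1⟩
    refine ⟨⟨b, hb⟩, ?_⟩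
    have inj : Function.Injective (fun f : B →ₗ[R] V => f b) := by
      intro f g hfg
      ext b'
      obtain ⟨r, rfl⟩ := hb b'
      simp only [map_smul]
      exact congrArg _ hfg
    have ns : v ∉ Set.range (fun f : B →ₗ[R] V => f b) := by
      rintro ⟨f, hf⟩
      obtain ⟨w, hw⟩ := exists_ne (0 : V)
      obtain ⟨r, hr⟩ := h (0, w)
      have h1 := (Prod.ext_iff.1 hr).1
      have h2 := (Prod.ext_iff.1 hr).2
      simp only [Prod.smul_mk] at h1 h2
      apply hw
      rw [← h2, ← hf]
      simp only
      rw [← map_smul, h1, map_zero]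
    rw [← Set.ncard_univ V, ← Set.ncard_univ (B →ₗ[R] V), ← Set.ncard_image_of_injective _ inj,
      Set.image_univ]
    exact Set.ncard_lt_ncard ⟨Set.subset_univ _, fun hh => ns (hh (Set.mem_univ v))⟩ (Set.toFinite _)
  · rintro ⟨⟨b, hb⟩, hlt⟩
    have : ¬ Function.Surjective (fun f : B →ₗ[R] V => f b) := fun hs =>
      have : Finite (B →ₗ[R] V) := Finite.of_injective _ DFunLike.coe_injective
      absurd (Nat.card_le_card_of_surjective _ hs) (not_le.2 hlt)
    simp only [Function.Surjective, not_forall, not_exists] at this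
    obtain ⟨v, hv⟩ := this
    let N : Submodule R (B × V) := Submodule.span R {(b, v)}
    have hN : (b, v) ∈ N := Submodule.mem_span_singleton_self _
    suffices hT : ∀ x, x ∈ N by
      exact ⟨(b, v), fun x => Submodule.mem_span_singleton.1 (hT x)⟩
    have sur : ∀ b', ∃ v', (b', v') ∈ N := fun b' => by
      obtain ⟨r, rfl⟩ := hb b'
      exact ⟨r • v, N.smul_mem r hN⟩
    rcases eq_bot_or_eq_top (N.comap (LinearMap.inr R B V)) with h0 | h1
    · exfalso
      let p : N →ₗ[R] B := (LinearMap.fst R B V).comp N.subtype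
      have bij : Function.Bijective p := by
        constructor
        · rw [injective_iff_map_eq_zero]
          rintro ⟨⟨x, y⟩, hxy⟩ hp
          have hx : x = 0 := hp
          subst hx
          have : y ∈ N.comap (LinearMap.inr R B V) := hxy
          rw [h0] at this
          have hy : y = 0 := this
          subst hy
          rfl
        · intro b'
          obtain ⟨v', hv'⟩ := sur b'
          exact ⟨⟨_, hv'⟩, rfl⟩
      let e := LinearEquiv.ofBijective p bij
      apply hv ((LinearMap.snd R B V).comp (N.subtype.comp e.symm.toLinearMap))
      have : e.symm b = ⟨(b, v), hN⟩ := by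
        rw [LinearEquiv.symm_apply_eq]; rfl
      simp [this]
    · rintro ⟨x, y⟩
      obtain ⟨v', hv'⟩ := sur x
      have : y - v' ∈ N.comap (LinearMap.inr R B V) := h1 ▸ Submodule.mem_top
      have := N.add_mem hv' this
      simpa using this

theorem sdual_prod {K : Type*} [Field K] {B V : Type*} [AddCommGroup B] [Module R B]
    [AddCommGroup V] [Module R V]
    [Finite B] [Finite V] [IsSimpleModule R V] (hfin : Finite (V →+ Additive Kˣ)) :
    SDual R (B × V) K ↔ SDual R B K ∧ Nat.card (V →ₗ[R] B) < Nat.card (V →+ Additive Kˣ) := by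
  have hnt : Nontrivial V := IsSimpleModule.nontrivial R V
  have inj : ∀ β : B →+ Additive Kˣ, (∀ N : Submodule R B, (∀ x ∈ N, β x = 0) → N = ⊥) →
      Function.Injective (fun f : V →ₗ[R] B => β.comp f.toAddMonoidHom) := by
    intro β hβ f g hfg
    have := hβ (LinearMap.range (f - g)) (by
      rintro _ ⟨y, rfl⟩
      have := DFunLike.congr_fun hfg y
      simp only [AddMonoidHom.comp_apply, LinearMap.toAddMonoidHom_coe] at this
      simp [this])
    rw [LinearMap.range_eq_bot] at this
    exact sub_eq_zero.1 this
  constructor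
  · rintro ⟨χ, hχ⟩
    have hβ : ∀ N : Submodule R B, (∀ x ∈ N, χ.comp (AddMonoidHom.inl B V) x = 0) → N = ⊥ := by
      intro N hN
      have := hχ (N.map (LinearMap.inl R B V)) (by
        rintro _ ⟨x, hx, rfl⟩
        exact hN x hx)
      rw [eq_bot_iff]
      intro x hx
      have h2 : LinearMap.inl R B V x ∈ N.map (LinearMap.inl R B V) := ⟨x, hx, rfl⟩
      rw [this] at h2
      simpa using h2
    refine ⟨⟨_, hβ⟩, ?_⟩
    have inj := inj _ hβ
    have ns : -χ.comp (AddMonoidHom.inr B V) ∉ Set.range (fun f : V →ₗ[R] B =>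
        (χ.comp (AddMonoidHom.inl B V)).comp f.toAddMonoidHom) := by
      rintro ⟨f, hf⟩
      have := hχ (LinearMap.range (f.prod LinearMap.id)) (by
        rintro _ ⟨y, rfl⟩
        have := DFunLike.congr_fun hf y
        simp only [AddMonoidHom.comp_apply, LinearMap.toAddMonoidHom_coe,
          AddMonoidHom.neg_apply, AddMonoidHom.inl_apply, AddMonoidHom.inr_apply] at this
        have h3 : (f.prod LinearMap.id) y = (f y, 0) + (0, y) := by simp
        rw [h3, map_add, this]; simp)
      rw [LinearMap.range_eq_bot] at this
      obtain ⟨w, hw⟩ := exists_ne (0 : V)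
      have := DFunLike.congr_fun this w
      exact hw (Prod.ext_iff.1 this).2
    rw [← Set.ncard_univ (V →+ Additive Kˣ), ← Set.ncard_univ (V →ₗ[R] B),
      ← Set.ncard_image_of_injective _ inj, Set.image_univ]
    exact Set.ncard_lt_ncard ⟨Set.subset_univ _, fun hh => ns (hh (Set.mem_univ _))⟩ (Set.toFinite _)
  · rintro ⟨⟨β, hβ⟩, hlt⟩
    have : ¬ Function.Surjective (fun f : V →ₗ[R] B => β.comp f.toAddMonoidHom) := fun hs =>
      have : Finite (V →ₗ[R] B) := Finite.of_injective _ DFunLike.coe_injective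
      absurd (Nat.card_le_card_of_surjective _ hs) (not_le.2 hlt)
    simp only [Function.Surjective, not_forall, not_exists] at this
    obtain ⟨ψ, hψ⟩ := this
    refine ⟨β.coprod (-ψ), fun N hN => ?_⟩
    have hN' : ∀ x y, (x, y) ∈ N → β x = ψ y := fun x y h => by
      have := hN _ h
      simp only [AddMonoidHom.coprod_apply, AddMonoidHom.neg_apply] at this
      rwa [← sub_eq_add_neg, sub_eq_zero] at this
    have h0 : N.comap (LinearMap.inl R B V) = ⊥ := hβ _ (fun x hx => by
      simpa using hN' x 0 hx)
    let p : N →ₗ[R] V := (LinearMap.snd R B V).comp N.subtype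
    have pinj : Function.Injective p := by
      rw [injective_iff_map_eq_zero]
      rintro ⟨⟨x, y⟩, hxy⟩ hp
      have hx : y = 0 := hp
      subst hx
      have : x ∈ N.comap (LinearMap.inl R B V) := hxy
      rw [h0] at this
      have hy : x = 0 := this
      subst hy
      rfl
    rcases eq_bot_or_eq_top (LinearMap.range p) with h1 | h1
    · rw [eq_bot_iff]
      intro x hx
      have h2 : p ⟨x, hx⟩ = 0 := by
        rw [LinearMap.range_eq_bot] at h1
        rw [h1]; rfl
      rw [← map_zero p] at h2
      have := pinj h2
      simpa using this
    · exfalso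
      let e := LinearEquiv.ofBijective p ⟨pinj, LinearMap.range_eq_top.1 h1⟩
      apply hψ ((LinearMap.fst R B V).comp (N.subtype.comp e.symm.toLinearMap))
      ext v
      have h3 := hN' (e.symm v).1.1 (e.symm v).1.2 (e.symm v).2
      have h4 : (e.symm v).1.2 = v := e.apply_symm_apply v
      rw [h4] at h3
      exact congrArg _ h3

/-- induction over finite semisimple modules -/
theorem ss_induction.{u} {R : Type*} [Ring R]
    {P : ∀ (A : Type u) [AddCommGroup A] [Module R A], Prop}
    (h0 : ∀ (A : Type u) [AddCommGroup A] [Module R A], Subsingleton A → P A)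
    (hc : ∀ (A B : Type u) [AddCommGroup A] [Module R A] [AddCommGroup B] [Module R B],
      (A ≃ₗ[R] B) → P A → P B)
    (hp : ∀ (B V : Type u) [AddCommGroup B] [Module R B] [AddCommGroup V] [Module R V],
      Finite B → Finite V → IsSemisimpleModule R B → IsSimpleModule R V → P B → P (B × V)) :
    ∀ (n : ℕ) (A : Type u) [AddCommGroup A] [Module R A], Finite A → IsSemisimpleModule R A →
      Nat.card A = n → P A := by
  intro n
  induction n using Nat.strong_induction_on with
  | _ n ih =>
    intro A _ _ hf hs hn
    rcases subsingleton_or_nontrivial A with h | h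
    · exact h0 A h
    · obtain ⟨V, hV⟩ := IsSemisimpleModule.exists_simple_submodule R A
      obtain ⟨B, hB⟩ := exists_isCompl V
      have hVn : Nontrivial V := IsSimpleModule.nontrivial R V
      let e := Submodule.prodEquivOfIsCompl B V hB.symm
      have hcard : Nat.card A = Nat.card B * Nat.card V := by
        rw [← Nat.card_congr e.toEquiv, Nat.card_prod]
      have hBpos : 0 < Nat.card B := Nat.card_pos
      have hV1 : 1 < Nat.card V := Finite.one_lt_card
      refine hc _ _ e (hp B V inferInstance inferInstance inferInstance hV
        (ih (Nat.card B) ?_ B inferInstance inferInstance rfl))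
      rw [← hn, hcard]
      nlinarith

theorem card_hom_comm.{u} {R : Type*} [Ring R] (V : Type u) [AddCommGroup V] [Module R V]
    [IsSimpleModule R V]
    (A : Type u) [AddCommGroup A] [Module R A] (hf : Finite A) (hs : IsSemisimpleModule R A) :
    Nat.card (V →ₗ[R] A) = Nat.card (A →ₗ[R] V) := by
  refine ss_induction (R := R) (P := fun A _ _ => Nat.card (V →ₗ[R] A) = Nat.card (A →ₗ[R] V))
    ?_ ?_ ?_ _ A hf hs rfl
  · intro A _ _ h
    rw [Nat.card_unique, Nat.card_unique]
  · intro A B _ _ _ _ e h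
    have h1 : Nat.card (V →ₗ[R] A) = Nat.card (V →ₗ[R] B) := Nat.card_congr
      ⟨fun f => e.toLinearMap ∘ₗ f, fun f => e.symm.toLinearMap ∘ₗ f,
        fun f => by ext; simp, fun f => by ext; simp⟩
    rw [← h1, h]
    exact Nat.card_congr
      ⟨fun f => f.comp e.symm.toLinearMap, fun f => f.comp e.toLinearMap,
        fun f => by ext; simp, fun f => by ext; simp⟩
  · intro B W _ _ _ _ _ _ _ hW h
    rw [← Nat.card_congr (LinearMap.prodEquiv ℕ : ((V →ₗ[R] B) × (V →ₗ[R] W)) ≃ₗ[ℕ] _).toEquiv,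
      ← Nat.card_congr (LinearMap.coprodEquiv ℕ : ((B →ₗ[R] V) × (W →ₗ[R] V)) ≃ₗ[ℕ] _).toEquiv,
      Nat.card_prod, Nat.card_prod, h]
    congr 1
    by_cases hVW : Nonempty (V ≃ₗ[R] W)
    · obtain ⟨e⟩ := hVW
      exact Nat.card_congr
        ⟨fun f => e.symm.toLinearMap ∘ₗ f ∘ₗ e.symm.toLinearMap,
          fun f => e.toLinearMap ∘ₗ f ∘ₗ e.toLinearMap,
          fun f => by ext; simp, fun f => by ext; simp⟩
    · have h1 : ∀ f : V →ₗ[R] W, f = 0 := fun f =>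
        (LinearMap.bijective_or_eq_zero f).resolve_left
          fun h => hVW ⟨LinearEquiv.ofBijective f h⟩
      have h2 : ∀ f : W →ₗ[R] V, f = 0 := fun f =>
        (LinearMap.bijective_or_eq_zero f).resolve_left
          fun h => hVW ⟨(LinearEquiv.ofBijective f h).symm⟩
      have : Subsingleton (V →ₗ[R] W) := ⟨fun f g => (h1 f).trans (h1 g).symm⟩
      have : Subsingleton (W →ₗ[R] V) := ⟨fun f g => (h2 f).trans (h2 g).symm⟩
      rw [Nat.card_unique, Nat.card_unique]

theorem enough_of_card {K : Type*} [Field K] [IsAlgClosed K] (A : Type*) [Group A] [Finite A]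
    (h : (Nat.card A : K) ≠ 0) : HasEnoughRootsOfUnity K (Monoid.exponent A) := by
  have : NeZero ((Monoid.exponent A : ℕ) : K) := ⟨fun h0 => h (by
    obtain ⟨c, hc⟩ := Group.exponent_dvd_nat_card (G := A)
    rw [hc]; simp [h0])⟩
  infer_instance

theorem sgen_iff_sdual.{u} {R : Type*} [Ring R] {K : Type*} [Field K] [IsAlgClosed K]
    (A : Type u) [AddCommGroup A] [Module R A] [hf : Finite A] [hs : IsSemisimpleModule R A]
    (hA : (Nat.card A : K) ≠ 0) : SGen R A ↔ SDual R A K := by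
  refine ss_induction (R := R) (P := fun A _ _ => (Nat.card A : K) ≠ 0 → (SGen R A ↔ SDual R A K))
    ?_ ?_ ?_ _ A hf hs rfl hA
  · intro A _ _ h _
    exact iff_of_true ⟨0, fun b => ⟨0, Subsingleton.elim _ _⟩⟩
      ⟨0, fun N _ => Subsingleton.elim _ _⟩
  · intro A B _ _ _ _ e h hB
    rw [← Nat.card_congr e.toEquiv] at hB
    exact ⟨fun x => ((h hB).1 (x.congr e.symm)).congr e, fun x => ((h hB).2 (x.congr e.symm)).congr e⟩
  · intro B V _ _ _ _ hB hV hBs hVs h hcard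
    rw [Nat.card_prod, Nat.cast_mul] at hcard
    have hv := right_ne_zero_of_mul hcard
    have := enough_of_card (K := K) (Multiplicative V) hv
    let e : (V →+ Additive Kˣ) ≃ (Multiplicative V →* Kˣ) := AddMonoidHom.toMultiplicativeLeft
    have hfin : Finite (V →+ Additive Kˣ) := Finite.of_equiv _ e.symm
    rw [sgen_prod, sdual_prod hfin, h (left_ne_zero_of_mul hcard), card_hom_comm V B hB hBs,
      Nat.card_congr e, CommGroup.card_monoidHom_of_hasEnoughRootsOfUnity]
    rfl

end duality

section groups
variable {G : Type*} [Group G]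

def AbMin (M : Subgroup G) : Prop := IsMinimalNormal M ∧ ∀ x ∈ M, ∀ y ∈ M, x * y = y * x
def NabMin (M : Subgroup G) : Prop := IsMinimalNormal M ∧ ¬ ∀ x ∈ M, ∀ y ∈ M, x * y = y * x

theorem le_of_inter {M N : Subgroup G} (hM : IsMinimalNormal M) (hN : N.Normal) {x : G}
    (hx : x ∈ M) (hx' : x ∈ N) (h1 : x ≠ 1) : M ≤ N := by
  have := hM.1
  have h := hM.2.2 (M ⊓ N) inferInstance (fun h => h1 (by
    have : x ∈ M ⊓ N := ⟨hx, hx'⟩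
    rw [h] at this; simpa using this)) inf_le_left
  exact inf_eq_left.1 h

theorem min_commute {M N : Subgroup G} (hM : IsMinimalNormal M) (hN : IsMinimalNormal N)
    (hne : M ≠ N) {x y : G} (hx : x ∈ M) (hy : y ∈ N) : x * y = y * x := by
  refine Subgroup.commute_of_normal_of_disjoint M N hM.1 hN.1 ?_ x y hx hy
  rw [Subgroup.disjoint_def]
  intro z hz hz'
  by_contra h
  exact hne (le_antisymm (le_of_inter hM hN.1 hz hz' h) (le_of_inter hN hM.1 hz' hz h))

theorem nab_center {T : Subgroup G} (hT : NabMin T) {z : G} (hz : z ∈ T)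
    (h : ∀ x ∈ T, x * z = z * x) : z = 1 := by
  by_contra hne
  have := hT.1.1
  have hle := le_of_inter hT.1 (N := Subgroup.centralizer (T : Set G)) inferInstance hz
    (Subgroup.mem_centralizer_iff.2 h) hne
  exact hT.2 fun x hx y hy => (Subgroup.mem_centralizer_iff.1 (hle hy)) x hx

/-- elements of sSup commute with anything commuting with all members -/
theorem sSup_commute {𝒯 : Set (Subgroup G)} {x z : G} (hz : z ∈ sSup 𝒯)
    (h : ∀ T ∈ 𝒯, ∀ t ∈ T, x * t = t * x) : x * z = z * x := by
  have : sSup 𝒯 ≤ Subgroup.centralizer {x} := sSup_le fun T hT t ht => by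
    rw [Subgroup.mem_centralizer_iff]
    rintro _ rfl
    exact h T hT t ht
  exact Subgroup.mem_centralizer_iff.1 (this hz) x rfl

theorem aSocle_comm_nab {T : Subgroup G} (hT : NabMin T) {a t : G} (ha : a ∈ aSocle G)
    (ht : t ∈ T) : t * a = a * t :=
  sSup_commute ha fun M hM m hm => by
    refine min_commute hT.1 hM.1 ?_ ht hm
    rintro rfl
    exact hT.2 hM.2

theorem aSocle_comm {a b : G} (ha : a ∈ aSocle G) (hb : b ∈ aSocle G) : a * b = b * a :=
  sSup_commute hb fun M hM m hm => by
    symm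
    refine sSup_commute ha fun N hN n hn => ?_
    by_cases h : M = N
    · subst h; exact hM.2 _ hm _ hn
    · exact min_commute hM.1 hN.1 h hm hn

theorem sSup_normal {𝒯 : Set (Subgroup G)} (h : ∀ T ∈ 𝒯, T.Normal) : (sSup 𝒯).Normal := by
  refine ⟨fun n hn g => ?_⟩
  have : sSup 𝒯 ≤ (sSup 𝒯).comap (MulAut.conj g).toMonoidHom := sSup_le fun T hT t ht => by
    have : g * t * g⁻¹ ∈ sSup 𝒯 := (le_sSup hT : T ≤ sSup 𝒯) ((h T hT).conj_mem t ht g)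
    simpa using this
  simpa using this hn

instance aSocle_normal : (aSocle G).Normal := sSup_normal fun _ h => h.1.1
instance socle_normal : (socle G).Normal := sSup_normal fun _ h => h.1

theorem nab_sSup_center (𝒯 : Finset (Subgroup G)) (h𝒯 : ∀ T ∈ 𝒯, NabMin T) :
    ∀ z ∈ sSup (𝒯 : Set (Subgroup G)), (∀ T ∈ 𝒯, ∀ t ∈ T, t * z = z * t) → z = 1 := by
  classical
  induction 𝒯 using Finset.induction_on with
  | empty => intro z hz _; simpa using hz
  | insert T s hTs ih =>
    intro z hz hc
    have hTn := h𝒯 T (Finset.mem_insert_self _ _)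
    have hs : ∀ T ∈ s, NabMin T := fun T h => h𝒯 T (Finset.mem_insert_of_mem h)
    rw [Finset.coe_insert, sSup_insert] at hz
    have := hTn.1.1
    obtain ⟨t, ht, x, hx, rfl⟩ := Subgroup.mem_sup_of_normal_left.1 hz
    have ht1 : t = 1 := by
      refine nab_center hTn ht fun y hy => ?_
      have h1 := hc T (Finset.mem_insert_self _ _) y hy
      have h2 : y * x = x * y := sSup_commute hx fun M hM m hm =>
        min_commute hTn.1 (hs M hM).1 (fun h => hTs (h ▸ hM)) hy hm
      rw [mul_assoc t x, ← h2, ← mul_assoc, ← mul_assoc] at h1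
      exact mul_right_cancel h1
    subst ht1
    simp only [one_mul] at hc ⊢
    exact ih hs x hx fun M hM => hc M (Finset.mem_insert_of_mem hM)

theorem nab_exists (𝒯 : Finset (Subgroup G)) (h𝒯 : ∀ T ∈ 𝒯, NabMin T) :
    ∃ t ∈ sSup (𝒯 : Set (Subgroup G)), ∀ T ∈ 𝒯, ∃ x ∈ T, x * t ≠ t * x := by
  classical
  induction 𝒯 using Finset.induction_on with
  | empty => exact ⟨1, one_mem _, by simp⟩
  | insert T s hTs ih =>
    have hTn := h𝒯 T (Finset.mem_insert_self _ _)
    have hs : ∀ T ∈ s, NabMin T := fun T h => h𝒯 T (Finset.mem_insert_of_mem h)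
    obtain ⟨t, ht, h⟩ := ih hs
    have hna := hTn.2
    push Not at hna
    obtain ⟨u, hu, w, hw, huw⟩ := hna
    have hcomm : ∀ y ∈ T, y * t = t * y := fun y hy => sSup_commute ht fun M hM m hm =>
        min_commute hTn.1 (hs M hM).1 (fun h => hTs (h ▸ hM)) hy hm
    refine ⟨t * w, ?_, ?_⟩
    · rw [Finset.coe_insert, sSup_insert]
      exact mul_mem (Subgroup.mem_sup_right ht) (Subgroup.mem_sup_left hw)
    · intro M hM
      rcases Finset.mem_insert.1 hM with rfl | hM
      · refine ⟨u, hu, fun h => huw ?_⟩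
        rw [← mul_assoc, hcomm u hu, mul_assoc, mul_assoc] at h
        exact mul_left_cancel h
      · obtain ⟨x, hx, hxt⟩ := h M hM
        refine ⟨x, hx, fun h => hxt ?_⟩
        have h2 : x * w = w * x :=
          min_commute (hs M hM).1 hTn.1 (fun h => hTs (h ▸ hM)) hx hw
        rw [mul_assoc t, ← h2, ← mul_assoc, ← mul_assoc] at h
        exact mul_right_cancel h

theorem exists_minimal [Finite G] (N : Subgroup G) (hN : N.Normal) (h : N ≠ ⊥) :
    ∃ M ≤ N, IsMinimalNormal M := by
  obtain ⟨M, hM⟩ := (Set.toFinite {M : Subgroup G | M.Normal ∧ M ≠ ⊥ ∧ M ≤ N}).exists_minimal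
    ⟨N, hN, h, le_rfl⟩
  exact ⟨M, hM.1.2.2, hM.1.1, hM.1.2.1, fun K hK hK' hle =>
    le_antisymm hle (hM.2 ⟨hK, hK', hle.trans hM.1.2.2⟩ hle)⟩

theorem socle_gen_iff [Finite G] :
    (∃ a ∈ socle G, Subgroup.normalClosure {a} = socle G) ↔
      ∃ a ∈ aSocle G, Subgroup.normalClosure {a} = aSocle G := by
  classical
  have : Fintype (Subgroup G) := Fintype.ofFinite _
  let 𝒯 : Finset (Subgroup G) := Finset.univ.filter NabMin
  have h𝒯 : ∀ T ∈ 𝒯, NabMin T := fun T h => (Finset.mem_filter.1 h).2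
  have h𝒯n : (sSup (𝒯 : Set (Subgroup G))).Normal := sSup_normal fun T hT => (h𝒯 T hT).1.1
  have hAS : aSocle G ≤ socle G := sSup_le_sSup fun M h => h.1
  have hTS : sSup (𝒯 : Set (Subgroup G)) ≤ socle G := sSup_le_sSup fun M h => (h𝒯 M h).1
  have hS : socle G ≤ aSocle G ⊔ sSup (𝒯 : Set (Subgroup G)) := by
    refine sSup_le fun M hM => ?_
    by_cases h : ∀ x ∈ M, ∀ y ∈ M, x * y = y * x
    · exact le_sup_of_le_left (le_sSup ⟨hM, h⟩)
    · exact le_sup_of_le_right (le_sSup (by simpa [𝒯] using ⟨hM, h⟩))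
  constructor
  · rintro ⟨s, hs, hsS⟩
    obtain ⟨a, ha, t, ht, rfl⟩ := Subgroup.mem_sup_of_normal_left.1 (hS hs)
    refine ⟨a, ha, le_antisymm (Subgroup.normalClosure_le_normal (by simpa using ha)) ?_⟩
    have h1 : socle G ≤ Subgroup.normalClosure {a} ⊔ sSup (𝒯 : Set (Subgroup G)) := by
      rw [← hsS]
      apply Subgroup.normalClosure_le_normal
      simp only [Set.singleton_subset_iff, SetLike.mem_coe]
      exact mul_mem (Subgroup.mem_sup_left (Subgroup.subset_normalClosure rfl))
        (Subgroup.mem_sup_right ht)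
    intro b hb
    obtain ⟨n, hn, u, hu, rfl⟩ := Subgroup.mem_sup_of_normal_left.1 (h1 (hAS hb))
    have hnA : n ∈ aSocle G := Subgroup.normalClosure_le_normal (by simpa using ha) hn
    have huA : u ∈ aSocle G := ((aSocle G).mul_mem_cancel_left hnA).1 hb
    have : u = 1 := nab_sSup_center 𝒯 h𝒯 u hu fun T hT t ht =>
      aSocle_comm_nab (h𝒯 T hT) huA ht
    subst this
    simpa using hn
  · rintro ⟨a, ha, haA⟩
    obtain ⟨t, ht, h⟩ := nab_exists 𝒯 h𝒯
    have hmem : a * t ∈ socle G := mul_mem (hAS ha) (hTS ht)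
    refine ⟨a * t, hmem,
      le_antisymm (Subgroup.normalClosure_le_normal (by simpa using hmem)) ?_⟩
    have hin : a * t ∈ Subgroup.normalClosure {a * t} := Subgroup.subset_normalClosure rfl
    have hT : ∀ T ∈ 𝒯, T ≤ Subgroup.normalClosure {a * t} := fun T hT => by
      obtain ⟨x, hx, hne⟩ := h T hT
      have hTn := (h𝒯 T hT).1.1
      have hxa := aSocle_comm_nab (h𝒯 T hT) ha hx
      refine le_of_inter (h𝒯 T hT).1 inferInstance (x := x * (a * t) * x⁻¹ * (a * t)⁻¹) ?_ ?_ ?_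
      · have := T.mul_mem hx (hTn.conj_mem x⁻¹ (T.inv_mem hx) (a * t))
        simpa only [mul_assoc] using this
      · exact mul_mem (Subgroup.normalClosure_normal.conj_mem _ hin x) (inv_mem hin)
      · intro h1
        apply hne
        rw [mul_inv_eq_one, mul_inv_eq_iff_eq_mul, ← mul_assoc, hxa, mul_assoc, mul_assoc] at h1
        exact mul_left_cancel h1
    have hTT : sSup (𝒯 : Set (Subgroup G)) ≤ Subgroup.normalClosure {a * t} := sSup_le hT
    have haN : a ∈ Subgroup.normalClosure {a * t} :=
      ((Subgroup.normalClosure {a * t}).mul_mem_cancel_right (hTT ht)).1 hin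
    refine hS.trans (sup_le ?_ hTT)
    rw [← haA]
    exact Subgroup.normalClosure_le_normal (by simpa using haN)

end groups

section translate
variable {G : Type*} [Group G]

instance aSocle_isComm : CommGroup (aSocle G) :=
  { (inferInstance : Group (aSocle G)) with
    mul_comm := fun a b => Subtype.ext (aSocle_comm a.2 b.2) }

noncomputable def conjRep (G : Type*) [Group G] : Representation ℤ G (Additive (aSocle G)) where
  toFun g := (MonoidHom.toAdditive
    ((MulAut.conjNormal g : MulAut (aSocle G)).toMonoidHom)).toIntLinearMap
  map_one' := by
    ext x
    simp
  map_mul' g h := by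
    ext x
    simp

abbrev AM (G : Type*) [Group G] := (conjRep G).asModule

def el (a : aSocle G) : AM G := Additive.ofMul a
def un (x : AM G) : aSocle G := Additive.toMul (show Additive (aSocle G) from x)

theorem el_un (x : AM G) : el (un x) = x := rfl
theorem un_el (x : aSocle G) : un (el x) = x := rfl
theorem un_add (x y : AM G) : un (x + y) = un x * un y := rfl
theorem un_zero : un (0 : AM G) = 1 := rfl
theorem un_neg (x : AM G) : un (-x) = (un x)⁻¹ := rfl
theorem un_smul (g : G) (x : AM G) :
    (un (MonoidAlgebra.of ℤ G g • x) : G) = g * un x * g⁻¹ := by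
  have : MonoidAlgebra.of ℤ G g • x = (conjRep G) g ((conjRep G).asModuleEquiv x) := by
    rw [MonoidAlgebra.of_apply, Representation.single_smul, one_smul]
  rw [this]
  rfl

noncomputable def toSub (N : Subgroup G) (hN : N.Normal) : Submodule (MonoidAlgebra ℤ G) (AM G) :=
  MonoidAlgebra.submoduleOfSMulMem
    (AddSubgroup.toIntSubmodule
      { carrier := {x : AM G | (un x : G) ∈ N}
        zero_mem' := by simp [un_zero]
        add_mem' := by
          intro a b ha hb
          simpa [un_add] using mul_mem ha hb
        neg_mem' := by
          intro a ha
          simpa [un_neg] using ha })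
    (fun g v hv => by
      change (un (MonoidAlgebra.of ℤ G g • v) : G) ∈ N
      rw [un_smul]
      exact hN.conj_mem _ hv g)

theorem mem_toSub {N : Subgroup G} {hN : N.Normal} {x : AM G} :
    x ∈ toSub N hN ↔ (un x : G) ∈ N := Iff.rfl

def fromSub (W : Submodule (MonoidAlgebra ℤ G) (AM G)) : Subgroup G where
  carrier := {g | ∃ h : g ∈ aSocle G, el ⟨g, h⟩ ∈ W}
  one_mem' := ⟨one_mem _, W.zero_mem⟩
  mul_mem' := by
    rintro a b ⟨ha, ha'⟩ ⟨hb, hb'⟩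
    exact ⟨mul_mem ha hb, W.add_mem ha' hb'⟩
  inv_mem' := by
    rintro a ⟨ha, ha'⟩
    exact ⟨inv_mem ha, W.neg_mem ha'⟩

theorem mem_fromSub {W : Submodule (MonoidAlgebra ℤ G) (AM G)} {x : AM G} :
    (un x : G) ∈ fromSub W ↔ x ∈ W := ⟨fun ⟨_, h⟩ => h, fun h => ⟨(un x).2, h⟩⟩

theorem fromSub_normal (W : Submodule (MonoidAlgebra ℤ G) (AM G)) : (fromSub W).Normal := by
  constructor
  rintro a ⟨ha, ha'⟩ g
  have := mem_fromSub.2 (W.smul_mem (MonoidAlgebra.of ℤ G g) ha')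
  rwa [un_smul] at this

theorem fromSub_le (W : Submodule (MonoidAlgebra ℤ G) (AM G)) : fromSub W ≤ aSocle G :=
  fun _ h => h.1

theorem fromSub_eq_bot {W : Submodule (MonoidAlgebra ℤ G) (AM G)} (h : fromSub W = ⊥) : W = ⊥ := by
  rw [eq_bot_iff]
  intro x hx
  have := mem_fromSub.2 hx
  rw [h, Subgroup.mem_bot] at this
  have h2 : un x = 1 := Subtype.ext this
  rw [Submodule.mem_bot, ← el_un x, h2]
  rfl

theorem AM_semisimple : IsSemisimpleModule (MonoidAlgebra ℤ G) (AM G) := by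
  apply IsSemisimpleModule.of_sSup_simples_eq_top
  have key : aSocle G ≤ fromSub (sSup {m : Submodule (MonoidAlgebra ℤ G) (AM G) |
      IsSimpleModule (MonoidAlgebra ℤ G) m}) := by
    refine sSup_le fun M hM => ?_
    have hMA : M ≤ aSocle G := le_sSup hM
    have hs : IsSimpleModule (MonoidAlgebra ℤ G) (toSub M hM.1.1) := by
      rw [isSimpleModule_iff_isAtom]
      constructor
      · intro h
        apply hM.1.2.1
        rw [eq_bot_iff]
        intro x hx
        have : el ⟨x, hMA hx⟩ ∈ toSub M hM.1.1 := hx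
        rw [h, Submodule.mem_bot] at this
        have h2 := congrArg un this
        rw [un_el, un_zero] at h2
        exact congrArg Subtype.val h2
      · intro W hW
        by_contra hne
        have h1 := hM.1.2.2 (fromSub W) (fromSub_normal W) (fun h => hne (fromSub_eq_bot h))
          (fun x hx => by
            obtain ⟨h, h'⟩ := hx
            exact mem_toSub.1 (hW.le h'))
        apply hW.not_ge
        intro x hx
        rw [← mem_fromSub, h1]
        exact hx
    intro x hx
    exact ⟨hMA hx, (le_sSup (a := toSub M hM.1.1) hs) hx⟩
  rw [eq_top_iff]
  intro x _
  exact mem_fromSub.1 (key (un x).2)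

theorem sgen_AM_iff : SGen (MonoidAlgebra ℤ G) (AM G) ↔
    ∃ a ∈ aSocle G, Subgroup.normalClosure {a} = aSocle G := by
  constructor
  · rintro ⟨x, hx⟩
    refine ⟨un x, (un x).2, le_antisymm (Subgroup.normalClosure_le_normal (by simp)) ?_⟩
    intro b hb
    obtain ⟨r, hr⟩ := hx (el ⟨b, hb⟩)
    have h1 : x ∈ toSub (Subgroup.normalClosure {(un x : G)}) inferInstance :=
      mem_toSub.2 (Subgroup.subset_normalClosure rfl)
    have h2 := Submodule.smul_mem _ r h1
    rw [hr] at h2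
    exact mem_toSub.1 h2
  · rintro ⟨a, ha, h⟩
    refine ⟨el ⟨a, ha⟩, fun b => ?_⟩
    rw [← Submodule.mem_span_singleton, ← mem_fromSub]
    have hn := fromSub_normal (Submodule.span (MonoidAlgebra ℤ G) {el ⟨a, ha⟩})
    refine Subgroup.normalClosure_le_normal (s := {a}) ?_ (by rw [h]; exact (un b).2)
    simp only [Set.singleton_subset_iff, SetLike.mem_coe]
    exact ⟨ha, Submodule.mem_span_singleton_self _⟩

def GDual (G K : Type*) [Group G] [Field K] : Prop :=
  ∃ χ : aSocle G →* Kˣ, ∀ M : Subgroup G, M.Normal → (hM : M ≤ aSocle G) →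
    (∀ x : aSocle G, (x : G) ∈ M → χ x = 1) → M = ⊥

theorem sdual_AM_iff {K : Type*} [Field K] : SDual (MonoidAlgebra ℤ G) (AM G) K ↔ GDual G K := by
  constructor
  · rintro ⟨χ, h⟩
    refine ⟨MonoidHom.toAdditive.symm (χ : Additive (aSocle G) →+ Additive Kˣ),
      fun M hMn hM hx => ?_⟩
    have := h (toSub M hMn) (fun x hx' => hx (un x) hx')
    rw [eq_bot_iff]
    intro x hx
    have h1 : el ⟨x, hM hx⟩ ∈ toSub M hMn := hx
    rw [this, Submodule.mem_bot] at h1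
    have h2 := congrArg un h1
    rw [un_el, un_zero] at h2
    exact congrArg Subtype.val h2
  · rintro ⟨χ, h⟩
    refine ⟨(MonoidHom.toAdditive χ : Additive (aSocle G) →+ Additive Kˣ), fun N hN => ?_⟩
    exact fromSub_eq_bot (h (fromSub N) (fromSub_normal N) (fromSub_le N)
      (fun x hx => hN (el x) (mem_fromSub.1 hx)))

theorem aSocle_gen_iff [Finite G] {K : Type*} [Field K] [IsAlgClosed K]
    (h : (Nat.card (aSocle G) : K) ≠ 0) :
    (∃ a ∈ aSocle G, Subgroup.normalClosure {a} = aSocle G) ↔ GDual G K := by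
  have := AM_semisimple (G := G)
  have : Finite (AM G) := inferInstanceAs (Finite (aSocle G))
  rw [← sgen_AM_iff, ← sdual_AM_iff]
  exact sgen_iff_sdual _ h

end translate

section fwd
variable {G : Type} [Group G] [Finite G] {F : Type} [Field F]

theorem fixed_all {V : Type} [AddCommGroup V] [Module F V] (ρ : Representation F G V)
    (hs : IsSimpleModule (MonoidAlgebra F G) ρ.asModule)
    (M : Subgroup G) (hM : M.Normal) (x : V) (hx : x ≠ 0) (hfix : ∀ m ∈ M, ρ m x = x) :
    ∀ m ∈ M, ∀ v, ρ m v = v := by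
  let W0 : Submodule F ρ.asModule :=
    { carrier := {v | ∀ m ∈ M, ρ m (ρ.asModuleEquiv v) = ρ.asModuleEquiv v}
      zero_mem' := by intro m _; simp
      add_mem' := by
        intro a b ha hb m hm
        rw [map_add, map_add, ha m hm, hb m hm]
      smul_mem' := by
        intro c a ha m hm
        rw [map_smul, map_smul, ha m hm] }
  let W := MonoidAlgebra.submoduleOfSMulMem (M := G) W0 (by
    intro g v hv m hm
    have h1 : ρ.asModuleEquiv (MonoidAlgebra.of F G g • v) = ρ g (ρ.asModuleEquiv v) := by
      rw [Representation.asModuleEquiv_map_smul, Representation.asAlgebraHom_of]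
    rw [h1]
    have h2 := hv (g⁻¹ * m * g) (by simpa using hM.conj_mem m hm g⁻¹)
    calc ρ m (ρ g (ρ.asModuleEquiv v)) = ρ g (ρ (g⁻¹ * m * g) (ρ.asModuleEquiv v)) := by
          rw [← Module.End.mul_apply, ← Module.End.mul_apply, ← map_mul, ← map_mul]
          congr 2
          group
      _ = _ := by rw [h2])
  have hxW : ρ.asModuleEquiv.symm x ∈ W := fun m hm => by simpa using hfix m hm
  rcases eq_bot_or_eq_top W with h | h
  · rw [h, Submodule.mem_bot] at hxW
    exact absurd (by simpa using hxW) hx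
  · intro m hm v
    have : ρ.asModuleEquiv.symm v ∈ W := h ▸ Submodule.mem_top
    simpa using this m hm

theorem forward_dual (ℓ : ℕ) [CharP F ℓ] {V : Type} [AddCommGroup V] [Module F V]
    (ρ : Representation F G V)
    (hs : IsSimpleModule (MonoidAlgebra F G) ρ.asModule)
    (hf : ∀ g : G, (∀ v, ρ g v = v) → g = 1) :
    ∃ (K : Type) (_ : Field K) (_ : IsAlgClosed K) (_ : CharP K ℓ), GDual G K := by
  let σ : Representation F (aSocle G) V := ρ.comp (aSocle G).subtype
  have hnt : Nontrivial ρ.asModule := IsSimpleModule.nontrivial (MonoidAlgebra F G) _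
  have hnt' : Nontrivial σ.asModule := hnt
  have hN : IsNoetherianRing (MonoidAlgebra F (aSocle G)) :=
    IsNoetherianRing.of_finite F _
  obtain ⟨p, hp⟩ := associatedPrimes.nonempty (MonoidAlgebra F (aSocle G)) σ.asModule
  obtain ⟨hpp, x, hpx⟩ := isAssociatedPrime_iff.1 hp
  have hmem : ∀ r, r ∈ p ↔ r • x = 0 := fun r => by
    rw [hpx, Submodule.mem_colon_singleton, Submodule.mem_bot]
  have hx : x ≠ 0 := by
    rintro rfl
    exact hpp.ne_top ((Ideal.eq_top_iff_one _).2 ((hmem 1).2 (by simp)))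
  let E := FractionRing (MonoidAlgebra F (aSocle G) ⧸ p)
  let K := AlgebraicClosure E
  let φ : MonoidAlgebra F (aSocle G) →+* K :=
    (algebraMap E K).comp ((algebraMap (MonoidAlgebra F (aSocle G) ⧸ p) E).comp
      (Ideal.Quotient.mk p))
  have hφ : ∀ r, φ r = 0 → r ∈ p := fun r hr => by
    rw [← Ideal.Quotient.eq_zero_iff_mem]
    apply IsFractionRing.injective (MonoidAlgebra F (aSocle G) ⧸ p) E
    apply (algebraMap E K).injective
    simpa [φ] using hr
  have hchar : CharP K ℓ := by
    let ψ : F →+* K := φ.comp (algebraMap F (MonoidAlgebra F (aSocle G)))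
    exact charP_of_injective_ringHom ψ.injective ℓ
  refine ⟨K, inferInstance, inferInstance, hchar, ?_⟩
  refine ⟨(φ.toMonoidHom.comp (MonoidAlgebra.of F (aSocle G))).toHomUnits, ?_⟩
  intro M hMn hM hχ
  rw [eq_bot_iff]
  intro m hm
  rw [Subgroup.mem_bot]
  apply hf
  refine fixed_all ρ hs M hMn (σ.asModuleEquiv x) (by simpa using hx) ?_ m hm
  intro m hm
  have h1 := congrArg Units.val (hχ ⟨m, hM hm⟩ hm)
  have h2 : φ (MonoidAlgebra.of F (aSocle G) ⟨m, hM hm⟩ - 1) = 0 := by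
    rw [map_sub, map_one, sub_eq_zero]
    exact h1
  have h3 := (hmem _).1 (hφ _ h2)
  rw [sub_smul, one_smul, sub_eq_zero] at h3
  have h4 := congrArg σ.asModuleEquiv h3
  rw [Representation.asModuleEquiv_map_smul, Representation.asAlgebraHom_of] at h4
  exact h4

theorem not_dvd_of_dual (ℓ : ℕ) (hℓ : ℓ.Prime) {K : Type} [Field K] [CharP K ℓ] (h : GDual G K) :
    ¬ ℓ ∣ Nat.card (aSocle G) := by
  intro hd
  have : Fact ℓ.Prime := ⟨hℓ⟩
  obtain ⟨χ, hχ⟩ := h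
  obtain ⟨x, hx⟩ := exists_prime_orderOf_dvd_card' ℓ hd
  let P : Subgroup G :=
    { carrier := {g | g ∈ aSocle G ∧ g ^ ℓ = 1}
      one_mem' := ⟨one_mem _, one_pow _⟩
      mul_mem' := by
        rintro a b ⟨ha, ha'⟩ ⟨hb, hb'⟩
        exact ⟨mul_mem ha hb, by rw [(show Commute a b from aSocle_comm ha hb).mul_pow, ha', hb', one_mul]⟩
      inv_mem' := by
        rintro a ⟨ha, ha'⟩
        exact ⟨inv_mem ha, by rw [inv_pow, ha', inv_one]⟩ }
  have hP : P = ⊥ := by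
    refine hχ P ⟨?_⟩ (fun g hg => hg.1) ?_
    · rintro a ⟨ha, ha'⟩ g
      exact ⟨aSocle_normal.conj_mem a ha g, by rw [conj_pow, ha']; simp⟩
    · rintro y ⟨_, hy⟩
      have hy' : y ^ ℓ = 1 := Subtype.ext hy
      have h1 : ((χ y : K)) ^ ℓ = 1 := by
        rw [← Units.val_pow_eq_pow_val, ← map_pow, hy', map_one, Units.val_one]
      have h2 : ((χ y : K) - 1) ^ ℓ = 0 := by
        rw [sub_pow_char, h1, one_pow, sub_self]
      ext
      exact sub_eq_zero.1 (pow_eq_zero_iff hℓ.ne_zero |>.1 h2)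
  have hxP : (x : G) ∈ P := ⟨x.2, by
    rw [← hx]; exact congrArg Subtype.val (pow_orderOf_eq_one x)⟩
  rw [hP, Subgroup.mem_bot] at hxP
  have : x = 1 := Subtype.ext hxP
  rw [this, orderOf_one] at hx
  exact hℓ.one_lt.ne hx

end fwd

section bwd
variable {G : Type} [Group G] [Finite G] {F : Type} [Field F]

theorem exists_rep (V : Type) [AddCommGroup V] [Module F V] [Module (MonoidAlgebra F G) V]
    [IsScalarTower F (MonoidAlgebra F G) V] [Module.Finite F V]
    [hs : IsSimpleModule (MonoidAlgebra F G) V]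
    (hf : ∀ g : G, (∀ v : V, MonoidAlgebra.of F G g • v = v) → g = 1) :
    ∃ (n : ℕ) (ρ : Representation F G (Fin n → F)),
        IsSimpleModule (MonoidAlgebra F G) ρ.asModule ∧
        ∀ g : G, (∀ v : Fin n → F, ρ g v = v) → g = 1 := by
  let e : V ≃ₗ[F] (Fin (Module.finrank F V) → F) := (Module.finBasis F V).equivFun
  let τ : Representation F G V := Representation.ofModule' V
  have hτ : ∀ g v, τ g v = MonoidAlgebra.of F G g • v := fun g v => rfl
  let ρ : Representation F G (Fin (Module.finrank F V) → F) :=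
    { toFun := fun g => e.toLinearMap ∘ₗ τ g ∘ₗ e.symm.toLinearMap
      map_one' := by ext; simp
      map_mul' := by intro g h; ext; simp }
  have hρ : ∀ g v, ρ g v = e (MonoidAlgebra.of F G g • e.symm v) := fun g v => rfl
  refine ⟨_, ρ, ?_, ?_⟩
  · let f : V →ₗ[MonoidAlgebra F G] ρ.asModule :=
      MonoidAlgebra.equivariantOfLinearOfComm (e.trans ρ.asModuleEquiv.symm).toLinearMap (by
        intro g v
        have := ρ.asModuleEquiv_symm_map_rho g (e v)
        rw [hρ, LinearEquiv.symm_apply_apply] at this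
        exact this)
    have hfb : Function.Bijective f := (e.trans ρ.asModuleEquiv.symm).bijective
    exact (LinearEquiv.ofBijective f hfb).isSimpleModule_iff.1 hs
  · intro g hg
    apply hf
    intro v
    have := hg (e v)
    rw [hρ, LinearEquiv.symm_apply_apply] at this
    exact e.injective this

theorem exists_faithful {B : Type} [Group B] (K : Type) [Field K] [Algebra F K]
    [Algebra.IsAlgebraic F K]
    (ι : B →* G) (hι : Function.Injective ι) (χ : B →* Kˣ)
    (h : ∀ M : Subgroup G, IsMinimalNormal M → ∃ b, ι b ∈ M ∧ χ b ≠ 1) :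
    ∃ (n : ℕ) (ρ : Representation F G (Fin n → F)),
        IsSimpleModule (MonoidAlgebra F G) ρ.asModule ∧
        ∀ g : G, (∀ v : Fin n → F, ρ g v = v) → g = 1 := by
  let c : G → K := Function.extend ι (fun b => (χ b : K)) 0
  have hc : ∀ b, c (ι b) = χ b := fun b => hι.extend_apply _ _ b
  have hcm : ∀ g b, c (g * ι b) = c g * χ b := by
    intro g b
    by_cases hg : ∃ b', ι b' = g
    · obtain ⟨b', rfl⟩ := hg
      rw [← map_mul, hc, hc, map_mul, Units.val_mul]
    · have hg' : ¬ ∃ b', ι b' = g * ι b := by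
        rintro ⟨b', hb'⟩
        exact hg ⟨b' * b⁻¹, by rw [map_mul, hb', map_inv, mul_inv_cancel_right]⟩
      simp only [c]
      rw [Function.extend_apply' _ _ _ hg, Function.extend_apply' _ _ _ hg']
      simp
  let Φ : MonoidAlgebra F G →ₗ[F] K :=
    (Finsupp.linearCombination F c).comp (MonoidAlgebra.coeffLinearEquiv F).toLinearMap
  have hΦ : ∀ g, Φ (MonoidAlgebra.of F G g) = c g := by
    intro g
    simp [Φ]
  let φ : MonoidAlgebra F B →ₐ[F] K :=
    MonoidAlgebra.lift F K B ((Units.coeHom K).comp χ)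
  have hφ : ∀ b, φ (MonoidAlgebra.of F B b) = χ b := fun b => by
    simp [φ]
  let ι' : MonoidAlgebra F B →ₐ[F] MonoidAlgebra F G := MonoidAlgebra.mapDomainAlgHom F F ι
  have hι' : ∀ b, ι' (MonoidAlgebra.of F B b) = MonoidAlgebra.of F G (ι b) := fun b => by
    simp [ι']
  have key : ∀ y w, Φ (y * ι' w) = Φ y * φ w := by
    intro y w
    induction w using MonoidAlgebra.induction_on with
    | of b =>
      rw [hι', hφ]
      induction y using MonoidAlgebra.induction_on with
      | of g => rw [← map_mul, hΦ, hΦ, hcm]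
      | add a b ha hb => rw [add_mul, map_add, map_add, ha, hb, add_mul]
      | smul r a ha => rw [smul_mul_assoc, map_smul, map_smul, ha, smul_mul_assoc]
    | add a b ha hb => rw [map_add, mul_add, map_add, map_add, ha, hb, mul_add]
    | smul r a ha => rw [map_smul, mul_smul_comm, map_smul, map_smul, ha, mul_smul_comm]
  let L : Ideal (MonoidAlgebra F G) :=
    { carrier := {x | ∀ y, Φ (y * x) = 0}
      zero_mem' := by intro y; simp
      add_mem' := by
        intro a b ha hb y
        rw [mul_add, map_add, ha, hb, add_zero]
      smul_mem' := by
        intro r a ha y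
        rw [smul_eq_mul, ← mul_assoc]
        exact ha _ }
  have hL : L ≠ ⊤ := by
    rw [Ideal.ne_top_iff_one]
    intro h1
    have h2 := h1 1
    have h3 : Φ (1 : MonoidAlgebra F G) = 1 := by
      have := hΦ 1
      rw [map_one] at this
      rw [this, ← map_one ι, hc, map_one, Units.val_one]
    rw [mul_one, h3] at h2
    exact one_ne_zero h2
  obtain ⟨J, hJ, hLJ⟩ := Ideal.exists_le_maximal L hL
  have hsimple : IsSimpleModule (MonoidAlgebra F G) (MonoidAlgebra F G ⧸ J) :=
    isSimpleModule_iff_isCoatom.2 hJ.out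
  have hfin : Module.Finite F (MonoidAlgebra F G ⧸ J) :=
    Module.Finite.of_surjective (J.mkQ.restrictScalars F) (Submodule.mkQ_surjective J)
  have hact : ∀ b, χ b ≠ 1 →
      ¬ ∀ v : MonoidAlgebra F G ⧸ J, MonoidAlgebra.of F G (ι b) • v = v := by
    intro b hb hv
    have h1 := hv (Submodule.Quotient.mk 1)
    rw [← Submodule.Quotient.mk_smul, Submodule.Quotient.eq, smul_eq_mul, mul_one] at h1
    have hne : (χ b : K) - 1 ≠ 0 := sub_ne_zero.2 fun h => hb (Units.ext h)
    have hmem : (χ b : K) - 1 ∈ φ.range := ⟨MonoidAlgebra.of F B b - 1, by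
      rw [← hφ, ← map_one φ, ← map_sub]; rfl⟩
    obtain ⟨z, hz⟩ := φ.range.inv_mem_of_algebraic (x := ⟨_, hmem⟩)
      (Algebra.IsAlgebraic.isAlgebraic (R := F) ((χ b : K) - 1))
    have hz' : φ z = ((χ b : K) - 1)⁻¹ := hz
    have hw : ι' (z * (MonoidAlgebra.of F B b - 1) - 1) ∈ L := fun y => by
      rw [key, map_sub, map_mul, map_sub, map_one, hφ, hz', inv_mul_cancel₀ hne, sub_self, mul_zero]
    have hw' := hLJ hw
    rw [map_sub, map_mul, map_sub, hι', map_one] at hw'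
    have h2 := J.mul_mem_left (ι' z) h1
    have h3 := J.sub_mem h2 hw'
    rw [sub_sub_cancel] at h3
    exact hJ.ne_top ((Ideal.eq_top_iff_one _).2 h3)
  refine exists_rep (MonoidAlgebra F G ⧸ J) ?_
  let N : Subgroup G :=
    { carrier := {g | ∀ v : MonoidAlgebra F G ⧸ J, MonoidAlgebra.of F G g • v = v}
      one_mem' := by intro v; rw [map_one, one_smul]
      mul_mem' := by
        intro a b ha hb v
        rw [map_mul, mul_smul, hb, ha]
      inv_mem' := by
        intro a ha v
        conv_lhs => rw [← ha v]
        rw [← mul_smul, ← map_mul, inv_mul_cancel, map_one, one_smul] }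
  have hNn : N.Normal := ⟨fun a ha g v => by
    rw [map_mul, map_mul, mul_smul, mul_smul, ha, ← mul_smul, ← map_mul, mul_inv_cancel, map_one,
      one_smul]⟩
  have hN : N = ⊥ := by
    by_contra hne
    obtain ⟨M, hMN, hM⟩ := exists_minimal N hNn hne
    obtain ⟨b, hb, hb'⟩ := h M hM
    exact hact b hb' (hMN hb)
  intro g hg
  have : g ∈ N := hg
  rwa [hN, Subgroup.mem_bot] at this

theorem exists_good_elt (ℓ : ℕ) [CharP F ℓ] {T : Subgroup G} (hT : NabMin T) :
    ∃ g ∈ T, g ≠ 1 ∧ ((orderOf g : ℕ) : F) ≠ 0 := by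
  have : ∃ q : ℕ, q.Prime ∧ q ∣ Nat.card T ∧ q ≠ ℓ := by
    by_contra hcon
    push Not at hcon
    have hp : Nat.card T = ℓ ^ (Nat.card T).primeFactorsList.length :=
      Nat.eq_prime_pow_of_unique_prime_dvd Nat.card_pos.ne' (fun {d} hd hd' => hcon d hd hd')
    have hTnt : Nontrivial T := (Subgroup.nontrivial_iff_ne_bot T).2 hT.1.2.1
    obtain ⟨q, hq, hqd⟩ := Nat.exists_prime_and_dvd (n := Nat.card T) Finite.one_lt_card.ne'
    have hql := hcon q hq hqd
    subst hql
    have : Fact q.Prime := ⟨hq⟩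
    have hpg : IsPGroup q T := IsPGroup.of_card hp
    have := hpg.center_nontrivial
    obtain ⟨z, hz⟩ := exists_ne (1 : Subgroup.center T)
    apply hz
    have := nab_center hT (z := ((z : T) : G)) z.1.2 (fun x hx =>
      congrArg Subtype.val (Subgroup.mem_center_iff.1 z.2 ⟨x, hx⟩))
    exact Subtype.ext (Subtype.ext this)
  obtain ⟨q, hq, hqd, hql⟩ := this
  have : Fact q.Prime := ⟨hq⟩
  obtain ⟨x, hx⟩ := exists_prime_orderOf_dvd_card' q hqd
  refine ⟨x, x.2, ?_, ?_⟩
  · intro h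
    have : x = 1 := Subtype.ext h
    rw [this, orderOf_one] at hx
    exact hq.one_lt.ne hx
  · rw [Subgroup.orderOf_coe, hx]
    intro h
    rw [CharP.cast_eq_zero_iff F ℓ] at h
    rcases (Nat.dvd_prime hq).1 h with h | h
    · exact CharP.char_ne_one F ℓ h
    · exact hql h.symm

theorem exists_char (ℓ : ℕ) [CharP F ℓ] {K : Type} [Field K] [Algebra F K] [IsAlgClosed K]
    (χ₀ : aSocle G →* Kˣ) (𝒯 : Finset (Subgroup G)) (h𝒯 : ∀ T ∈ 𝒯, NabMin T) :
    ∃ (B : Type) (_ : Group B) (ι : B →* G) (χ : B →* Kˣ), Function.Injective ι ∧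
      (∀ b, ι b ∈ aSocle G ⊔ sSup (𝒯 : Set (Subgroup G))) ∧
      (∀ a : aSocle G, ∃ b, ι b = a ∧ χ b = χ₀ a) ∧
      ∀ T ∈ 𝒯, ∃ b, ι b ∈ T ∧ χ b ≠ 1 := by
  classical
  induction 𝒯 using Finset.induction_on with
  | empty =>
    exact ⟨aSocle G, inferInstance, (aSocle G).subtype, χ₀, Subtype.val_injective,
      fun b => Subgroup.mem_sup_left b.2, fun a => ⟨a, rfl, rfl⟩, by simp⟩
  | insert T s hTs ih =>
    have hTn := h𝒯 T (Finset.mem_insert_self _ _)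
    have hs : ∀ T ∈ s, NabMin T := fun T h => h𝒯 T (Finset.mem_insert_of_mem h)
    obtain ⟨B, _, ι, χ, hι, hB, hA, hT⟩ := ih hs
    obtain ⟨g, hgT, hg1, hgo⟩ := exists_good_elt (F := F) ℓ hTn
    have hcomm : ∀ y ∈ T, ∀ b, y * ι b = ι b * y := by
      intro y hy b
      have := hB b
      rw [← sSup_insert] at this
      refine sSup_commute this fun M hM m hm => ?_
      rcases hM with rfl | hM
      · exact aSocle_comm_nab hTn hm hy
      · exact min_commute hTn.1 (hs M hM).1 (fun h => hTs (h ▸ hM)) hy hm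
    have hC : ∀ c : Subgroup.zpowers g, (c : G) ∈ T := fun c =>
      (Subgroup.zpowers_le.2 hgT) c.2
    obtain ⟨ψ, hψ⟩ : ∃ ψ : Subgroup.zpowers g →* Kˣ, ψ ⟨g, Subgroup.mem_zpowers g⟩ ≠ 1 := by
      let _ : CommGroup (Subgroup.zpowers g) := IsCyclic.commGroup
      have := enough_of_card (K := K) (Subgroup.zpowers g) (by
        rw [Nat.card_zpowers]
        intro h0
        apply hgo
        apply (algebraMap F K).injective
        rw [map_natCast, map_zero, h0])
      exact CommGroup.exists_apply_ne_one_of_hasEnoughRootsOfUnity (Subgroup.zpowers g) K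
        (fun h => hg1 (congrArg Subtype.val h))
    have hcm : ∀ (b : B) (c : Subgroup.zpowers g), Commute (ι b) ((Subgroup.zpowers g).subtype c) :=
      fun b c => (hcomm c (hC c) b).symm
    refine ⟨B × Subgroup.zpowers g, inferInstance,
      ι.noncommCoprod (Subgroup.zpowers g).subtype hcm,
      χ.coprod ψ, ?_, ?_, ?_, ?_⟩
    · rw [MonoidHom.noncommCoprod_injective]
      refine ⟨hι, Subtype.val_injective, ?_⟩
      rw [Subgroup.disjoint_def]
      rintro z ⟨b, rfl⟩ ⟨c, hc⟩
      refine nab_center hTn ?_ (fun y hy => hcomm y hy b)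
      rw [← hc]; exact hC c
    · rintro ⟨b, c⟩
      rw [MonoidHom.noncommCoprod_apply, Finset.coe_insert, sSup_insert]
      refine mul_mem ?_ (Subgroup.mem_sup_right (Subgroup.mem_sup_left (hC c)))
      exact (sup_le_sup_left le_sup_right _ : aSocle G ⊔ sSup (s : Set (Subgroup G)) ≤ _) (hB b)
    · intro a
      obtain ⟨b, hb, hb'⟩ := hA a
      exact ⟨(b, 1), by simp [hb], by simp [hb']⟩
    · intro M hM
      rcases Finset.mem_insert.1 hM with rfl | hM
      · exact ⟨(1, ⟨g, Subgroup.mem_zpowers g⟩), by simpa using hgT, by simpa using hψ⟩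
      · obtain ⟨b, hb, hb'⟩ := hT M hM
        exact ⟨(b, 1), by simpa using hb, by simpa using hb'⟩

end bwd

/-- Gaschütz's theorem: a finite group `G` has a faithful irreducible representation
over a field `F` of characteristic `ℓ` (i.e. there is a simple `F[G]`-module on which
`G` acts faithfully) if and only if `ℓ ∤ |A(G)|` and the socle `S(G)` is generated as a
normal subgroup of `G` by a single element. -/
theorem gaschutz_theorem (G : Type) [Group G] [Finite G] (F : Type) [Field F]
    (ℓ : ℕ) [CharP F ℓ] :
    (∃ (n : ℕ) (ρ : Representation F G (Fin n → F)),
        IsSimpleModule (MonoidAlgebra F G) ρ.asModule ∧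
        ∀ g : G, (∀ v : Fin n → F, ρ g v = v) → g = 1) ↔
      (¬ (ℓ ∣ Nat.card ↥(aSocle G)) ∧
        ∃ a ∈ socle G, Subgroup.normalClosure {a} = socle G) := by
  rw [socle_gen_iff]
  constructor
  · rintro ⟨n, ρ, hs, hf⟩
    obtain ⟨K, _, _, _, hK⟩ := forward_dual ℓ ρ hs hf
    have hnd : ¬ (ℓ ∣ Nat.card ↥(aSocle G)) := by
      rcases CharP.char_is_prime_or_zero F ℓ with hℓ | hℓ
      · exact not_dvd_of_dual ℓ hℓ hK
      · rw [hℓ, zero_dvd_iff]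
        exact Nat.card_pos.ne'
    refine ⟨hnd, (aSocle_gen_iff (K := K) ?_).2 hK⟩
    rwa [Ne, CharP.cast_eq_zero_iff K ℓ]
  · rintro ⟨hnd, hgen⟩
    let K := AlgebraicClosure F
    have hc : (Nat.card (aSocle G) : K) ≠ 0 := by
      have : CharP K ℓ := charP_of_injective_algebraMap (algebraMap F K).injective ℓ
      rwa [Ne, CharP.cast_eq_zero_iff K ℓ]
    obtain ⟨χ₀, hχ₀⟩ := (aSocle_gen_iff (K := K) hc).1 hgen
    classical
    have : Fintype (Subgroup G) := Fintype.ofFinite _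
    let 𝒯 : Finset (Subgroup G) := Finset.univ.filter NabMin
    obtain ⟨B, _, ι, χ, hι, -, hA, hT⟩ := exists_char (F := F) ℓ χ₀ 𝒯
      (fun T h => (Finset.mem_filter.1 h).2)
    refine exists_faithful K ι hι χ fun M hM => ?_
    by_cases hab : ∀ x ∈ M, ∀ y ∈ M, x * y = y * x
    · by_contra hcon
      push Not at hcon
      refine hM.2.1 (hχ₀ M hM.1 (le_sSup ⟨hM, hab⟩) fun x hx => ?_)
      obtain ⟨b, hb, hb'⟩ := hA x
      rw [← hb']
      exact hcon b (hb ▸ hx)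
    · exact hT M (Finset.mem_filter.2 ⟨Finset.mem_univ _, hM, hab⟩)
end
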